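/- arXiv:2002.05750 — 2 statements merged into one kernel-verified Lean document; each statement's English description precedes it below -/
import Mathlib

section
/- Let d ≥ 4 and 1 ≤ d₁, d₂ ≤ d be integers with d₁ + d₂ > d and (d, d₁, d₂) ≠ (4, 3, 2). Then the M_d(d₁,d₂) balanced excited random walk on ℤ^d is transient, i.e., almost surely every site of ℤ^d is visited only finitely many times. -/
open MeasureTheory Filter

/-- The `i`-th canonical unit vector of `ℤ^d`. -/
def unitVec (d : ℕ) (i : Fin d) : Fin d → ℤ := fun j => if j = i then 1 else 0

/-- `S` is a balanced excited random walk `M_d(d₁,d₂)` under `P`: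
it starts at `0` a.s., is measurable, and conditionally on any finite trajectory
`S_0 = h 0, …, S_n = h n`, if `h n` is a new site the walk jumps to `h n ± e_i`
with probability `1/(2d₁)` for each `i < d₁` (`0`-indexed), while if `h n` is an
old site it jumps to `h n ± e_i` with probability `1/(2d₂)` for each
`d - d₂ ≤ i < d` (`0`-indexed). -/
def IsBERW {Ω : Type*} [MeasurableSpace Ω] (d d₁ d₂ : ℕ) (P : Measure Ω)
    (S : ℕ → Ω → Fin d → ℤ) : Prop :=
  (∀ n, Measurable (S n)) ∧
  (∀ᵐ ω ∂P, S 0 ω = 0) ∧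
  (∀ (n : ℕ) (h : ℕ → Fin d → ℤ), (∀ k < n, h n ≠ h k) →
    ∀ i : Fin d, i.1 < d₁ → ∀ ε : ℤ, ε = 1 ∨ ε = -1 →
      P {ω | (∀ k ≤ n, S k ω = h k) ∧ S (n + 1) ω = h n + ε • unitVec d i}
        = P {ω | ∀ k ≤ n, S k ω = h k} / (2 * d₁)) ∧
  (∀ (n : ℕ) (h : ℕ → Fin d → ℤ), (∃ k < n, h n = h k) →
    ∀ i : Fin d, d - d₂ ≤ i.1 → ∀ ε : ℤ, ε = 1 ∨ ε = -1 →
      P {ω | (∀ k ≤ n, S k ω = h k) ∧ S (n + 1) ω = h n + ε • unitVec d i}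
        = P {ω | ∀ k ≤ n, S k ω = h k} / (2 * d₂))

/-- Transience: almost surely, every site is visited only finitely many times. -/
def IsTransientWalk {Ω : Type*} [MeasurableSpace Ω] (d : ℕ) (P : Measure Ω)
    (S : ℕ → Ω → Fin d → ℤ) : Prop :=
  ∀ᵐ ω ∂P, ∀ x : Fin d → ℤ, {n : ℕ | S n ω = x}.Finite

/-- The trajectory up to time `n`, most recent position first. -/
def walkHist {Ω : Type*} {d : ℕ} (S : ℕ → Ω → Fin d → ℤ) (ω : Ω) : ℕ → List (Fin d → ℤ)
  | 0 => [S 0 ω]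
  | n + 1 => S (n + 1) ω :: walkHist S ω n

/-- The directions available to `M_d(d₁,d₂)` at `x` after the trajectory `t`. -/
def berwDirs (d d₁ d₂ : ℕ) (x : Fin d → ℤ) (t : List (Fin d → ℤ)) : Finset (Fin d) :=
  if x ∈ t then Finset.univ.filter (fun i => d - d₂ ≤ i.1) else Finset.univ.filter (fun i => i.1 < d₁)

/-- The average of `g` over the neighbours of `x` in the directions `I`. -/
noncomputable def nbrAvg {d : ℕ} (I : Finset (Fin d)) (g : (Fin d → ℤ) → ℝ) (x : Fin d → ℤ) : ℝ :=
  (∑ i ∈ I, (g (x + unitVec d i) + g (x - unitVec d i))) / (2 * I.card)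

/-- The transition operator of `M_d(d₁,d₂)` on functions of the trajectory. -/
noncomputable def berwOp (d d₁ d₂ : ℕ) (φ : List (Fin d → ℤ) → ℝ) : List (Fin d → ℤ) → ℝ
  | [] => 0
  | x :: t => nbrAvg (berwDirs d d₁ d₂ x t) (fun y => φ (y :: x :: t)) x

/-- The expectation of `φ` over the first `n` steps of `M_d(d₁,d₂)`. -/
noncomputable def berwExp (d d₁ d₂ n : ℕ) (φ : List (Fin d → ℤ) → ℝ) : ℝ :=
  ((berwOp d d₁ d₂)^[n] φ) [0]

section Average

variable {d : ℕ} {I : Finset (Fin d)} {g g' : (Fin d → ℤ) → ℝ} {x : Fin d → ℤ}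

theorem nbrAvg_mono (h : ∀ i ∈ I, g (x + unitVec d i) + g (x - unitVec d i) ≤
    g' (x + unitVec d i) + g' (x - unitVec d i)) : nbrAvg I g x ≤ nbrAvg I g' x := by
  unfold nbrAvg
  have := Finset.sum_le_sum h
  gcongr

theorem nbrAvg_add : nbrAvg I (fun y => g y + g' y) x = nbrAvg I g x + nbrAvg I g' x := by
  unfold nbrAvg
  rw [← add_div, ← Finset.sum_add_distrib]
  congr 1
  exact Finset.sum_congr rfl fun i _ => by ring

theorem nbrAvg_const_mul (c : ℝ) : nbrAvg I (fun y => c * g y) x = c * nbrAvg I g x := by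
  unfold nbrAvg
  rw [mul_div_assoc', Finset.mul_sum]
  congr 1
  exact Finset.sum_congr rfl fun i _ => by ring

theorem nbrAvg_const (hI : I.Nonempty) (c : ℝ) : nbrAvg I (fun _ => c) x = c := by
  unfold nbrAvg
  have : (I.card : ℝ) ≠ 0 := by exact_mod_cast hI.card_pos.ne'
  simp only [Finset.sum_const, nsmul_eq_mul]
  field_simp
  ring

theorem nbrAvg_nonneg (h : ∀ y, 0 ≤ g y) : 0 ≤ nbrAvg I g x :=
  div_nonneg (Finset.sum_nonneg fun _ _ => add_nonneg (h _) (h _)) (by positivity)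

end Average

section Operator

variable {d d₁ d₂ : ℕ} {φ ψ ξ : List (Fin d → ℤ) → ℝ}

theorem berwOp_cons (x : Fin d → ℤ) (t : List (Fin d → ℤ)) : berwOp d d₁ d₂ φ (x :: t) =
    nbrAvg (berwDirs d d₁ d₂ x t) (fun y => φ (y :: x :: t)) x := rfl

theorem berwOp_mono (h : ∀ x t, φ (x :: t) ≤ ψ (x :: t)) (l : List (Fin d → ℤ)) :
    berwOp d d₁ d₂ φ l ≤ berwOp d d₁ d₂ ψ l := by
  cases l with
  | nil => exact le_rfl
  | cons x t =>
    rw [berwOp_cons, berwOp_cons]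
    exact nbrAvg_mono fun i _ => add_le_add (h _ _) (h _ _)

theorem berwOp_nonneg (h : ∀ l, 0 ≤ φ l) (l : List (Fin d → ℤ)) : 0 ≤ berwOp d d₁ d₂ φ l := by
  cases l with
  | nil => exact le_rfl
  | cons x t =>
    rw [berwOp_cons]
    exact nbrAvg_nonneg fun i => h _

theorem berwOp_add : berwOp d d₁ d₂ (φ + ψ) = berwOp d d₁ d₂ φ + berwOp d d₁ d₂ ψ := by
  funext l
  cases l with
  | nil => simp [berwOp]
  | cons x t =>
    simp only [Pi.add_apply, berwOp_cons]
    exact nbrAvg_add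

theorem berwOp_smul (c : ℝ) : berwOp d d₁ d₂ (c • φ) = c • berwOp d d₁ d₂ φ := by
  funext l
  cases l with
  | nil => simp [berwOp]
  | cons x t =>
    simp only [Pi.smul_apply, berwOp_cons, smul_eq_mul]
    exact nbrAvg_const_mul c

theorem berwExp_succ (n : ℕ) :
    berwExp d d₁ d₂ (n + 1) φ = berwExp d d₁ d₂ n (berwOp d d₁ d₂ φ) := by
  simp [berwExp, Function.iterate_succ_apply]

theorem berwExp_mono (n : ℕ) (h : ∀ x t, φ (x :: t) ≤ ψ (x :: t)) :
    berwExp d d₁ d₂ n φ ≤ berwExp d d₁ d₂ n ψ := by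
  induction n generalizing φ ψ with
  | zero => exact h _ _
  | succ n ih =>
    rw [berwExp_succ, berwExp_succ]
    exact ih fun x t => berwOp_mono h _

theorem berwExp_nonneg (n : ℕ) (h : ∀ l, 0 ≤ φ l) : 0 ≤ berwExp d d₁ d₂ n φ := by
  induction n generalizing φ with
  | zero => exact h _
  | succ n ih =>
    rw [berwExp_succ]
    exact ih fun l => berwOp_nonneg h _

theorem berwExp_add (n : ℕ) :
    berwExp d d₁ d₂ n (φ + ψ) = berwExp d d₁ d₂ n φ + berwExp d d₁ d₂ n ψ := by
  induction n generalizing φ ψ with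
  | zero => rfl
  | succ n ih => rw [berwExp_succ, berwExp_succ, berwExp_succ, berwOp_add, ih]

theorem berwExp_smul (n : ℕ) (c : ℝ) :
    berwExp d d₁ d₂ n (c • φ) = c * berwExp d d₁ d₂ n φ := by
  induction n generalizing φ with
  | zero => rfl
  | succ n ih => rw [berwExp_succ, berwExp_succ, berwOp_smul, ih]

/-- Summed drift inequality. -/
theorem berwExp_drift (h : ∀ x t, berwOp d d₁ d₂ φ (x :: t) + ψ (x :: t) ≤ φ (x :: t) + ξ (x :: t))
    (N : ℕ) : berwExp d d₁ d₂ N φ + ∑ n ∈ Finset.range N, berwExp d d₁ d₂ n ψ ≤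
      φ [0] + ∑ n ∈ Finset.range N, berwExp d d₁ d₂ n ξ := by
  induction N with
  | zero => simp [berwExp]
  | succ N ih =>
    have := berwExp_mono (d₁ := d₁) (d₂ := d₂) (φ := berwOp d d₁ d₂ φ + ψ) (ψ := φ + ξ) N h
    rw [berwExp_add, berwExp_add, ← berwExp_succ] at this
    rw [Finset.sum_range_succ, Finset.sum_range_succ]
    linarith

theorem sum_berwExp_le (hφ : ∀ l, 0 ≤ φ l)
    (h : ∀ x t, berwOp d d₁ d₂ φ (x :: t) + ψ (x :: t) ≤ φ (x :: t))
    (N : ℕ) : ∑ n ∈ Finset.range N, berwExp d d₁ d₂ n ψ ≤ φ [0] := by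
  have h1 := berwExp_drift (d₁ := d₁) (d₂ := d₂) (φ := φ) (ψ := ψ) (ξ := (0 : ℝ) • φ)
    (fun x t => by simpa using h x t) N
  simp only [berwExp_smul, zero_mul, Finset.sum_const_zero, add_zero] at h1
  linarith [berwExp_nonneg (d₁ := d₁) (d₂ := d₂) N hφ]

end Operator

section Law

variable {Ω : Type*} {d : ℕ} {S : ℕ → Ω → Fin d → ℤ}

theorem mem_walkHist {ω : Ω} {n : ℕ} {y : Fin d → ℤ} :
    y ∈ walkHist S ω n ↔ ∃ k ≤ n, S k ω = y := by
  induction n with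
  | zero => simp [walkHist, eq_comm]
  | succ n ih =>
    simp only [walkHist, List.mem_cons, ih]
    constructor
    · rintro (h | ⟨k, hk, h⟩)
      · exact ⟨n + 1, le_rfl, h.symm⟩
      · exact ⟨k, by omega, h⟩
    · rintro ⟨k, hk, h⟩
      rcases Nat.lt_or_eq_of_le hk with h1 | h1
      · exact Or.inr ⟨k, by omega, h⟩
      · exact Or.inl (h1 ▸ h.symm)

theorem walkHist_eq_iff {ω ω' : Ω} {n : ℕ} :
    walkHist S ω n = walkHist S ω' n ↔ ∀ k ≤ n, S k ω = S k ω' := by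
  induction n with
  | zero => simp [walkHist]
  | succ n ih =>
    simp only [walkHist, List.cons.injEq, ih]
    constructor
    · rintro ⟨h1, h2⟩ k hk
      rcases Nat.lt_or_eq_of_le hk with h | h
      · exact h2 k (by omega)
      · exact h ▸ h1
    · exact fun h => ⟨h _ le_rfl, fun k hk => h k (by omega)⟩

theorem walkHist_eq_cons (ω : Ω) (n : ℕ) :
    walkHist S ω n = S n ω :: (walkHist S ω n).tail := by
  cases n <;> rfl

theorem mem_tail_walkHist {ω : Ω} {n : ℕ} {y : Fin d → ℤ} :
    y ∈ (walkHist S ω n).tail ↔ ∃ k < n, S k ω = y := by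
  cases n with
  | zero => simp [walkHist]
  | succ n => simp [walkHist, mem_walkHist]

theorem unitVec_injective {x : Fin d → ℤ} {i j : Fin d} {a b : ℤ}
    (ha : a = 1 ∨ a = -1) (h : x + a • unitVec d i = x + b • unitVec d j) :
    i = j ∧ a = b := by
  have h' : a • unitVec d i = b • unitVec d j := add_left_cancel h
  have h1 := congrFun h' i
  simp only [Pi.smul_apply, unitVec, smul_eq_mul, if_true, mul_one] at h1
  by_cases hij : i = j
  · subst hij
    exact ⟨rfl, by simpa using h1⟩
  · rw [if_neg hij] at h1
    omega

variable [MeasurableSpace Ω]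

theorem measurableSet_walkHist_eq (hS : ∀ n, Measurable (S n)) (n : ℕ) (l : List (Fin d → ℤ)) :
    MeasurableSet {ω | walkHist S ω n = l} := by
  induction n generalizing l with
  | zero =>
    cases l with
    | nil => simp [walkHist]
    | cons x t =>
      have : {ω | walkHist S ω 0 = x :: t} = S 0 ⁻¹' {x} ∩ {_ω | t = []} := by
        ext ω; simp [walkHist, eq_comm]
      rw [this]
      exact (hS 0 (measurableSet_singleton x)).inter (MeasurableSet.const _)
  | succ n ih =>
    cases l with
    | nil => simp [walkHist]
    | cons x t =>
      have : {ω | walkHist S ω (n + 1) = x :: t} = S (n + 1) ⁻¹' {x} ∩ {ω | walkHist S ω n = t} := by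
        ext ω; simp [walkHist]
      rw [this]
      exact (hS _ (measurableSet_singleton x)).inter (ih t)

variable {d₁ d₂ : ℕ} {P : Measure Ω}

theorem card_newDirs (hd₁ : d₁ ≤ d) :
    (Finset.univ.filter (fun i : Fin d => i.1 < d₁)).card = d₁ := by
  have : (Finset.univ.filter (fun i : Fin d => i.1 < d₁)).card
      = (Finset.range d₁).card := by
    refine Finset.card_bij (fun i _ => i.1) ?_ ?_ ?_
    · intro i hi; simpa using hi
    · intro i _ j _ h; exact Fin.ext h
    · intro b hb
      have hb' := Finset.mem_range.1 hb
      exact ⟨⟨b, by omega⟩, by simpa using hb', rfl⟩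
  simpa using this

theorem card_oldDirs (hd₂ : d₂ ≤ d) :
    (Finset.univ.filter (fun i : Fin d => d - d₂ ≤ i.1)).card = d₂ := by
  have : (Finset.univ.filter (fun i : Fin d => d - d₂ ≤ i.1)).card
      = (Finset.Ico (d - d₂) d).card := by
    refine Finset.card_bij (fun i _ => i.1) ?_ ?_ ?_
    · intro i hi; simpa using hi
    · intro i _ j _ h; exact Fin.ext h
    · intro b hb
      have hb' := Finset.mem_Ico.1 hb
      exact ⟨⟨b, by omega⟩, by simpa using hb'.1, rfl⟩
  rw [this, Nat.card_Ico]
  omega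

theorem IsBERW.measure_step (hS : IsBERW d d₁ d₂ P S) (h1' : d₁ ≤ d) (h2' : d₂ ≤ d)
    (n : ℕ) (x : Fin d → ℤ) (t : List (Fin d → ℤ)) (i : Fin d)
    (hi : i ∈ berwDirs d d₁ d₂ x t) (a : ℤ) (ha : a = 1 ∨ a = -1) :
    P ({ω | walkHist S ω n = x :: t} ∩ {ω | S (n + 1) ω = x + a • unitVec d i})
      = P {ω | walkHist S ω n = x :: t} / (2 * (berwDirs d d₁ d₂ x t).card) := by
  rcases Set.eq_empty_or_nonempty {ω | walkHist S ω n = x :: t} with he | ⟨ω₀, h₀⟩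
  · simp [he]
  have hx : S n ω₀ = x ∧ (walkHist S ω₀ n).tail = t := by
    have := walkHist_eq_cons (S := S) ω₀ n
    rw [show walkHist S ω₀ n = x :: t from h₀] at this ⊢
    simpa [eq_comm] using this
  have hset : {ω | walkHist S ω n = x :: t} = {ω | ∀ k ≤ n, S k ω = S k ω₀} := by
    ext ω
    rw [Set.mem_ofPred_eq, ← show walkHist S ω₀ n = x :: t from h₀, walkHist_eq_iff, Set.mem_ofPred_eq]
  have hset' : {ω | walkHist S ω n = x :: t} ∩ {ω | S (n + 1) ω = x + a • unitVec d i} =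
      {ω | (∀ k ≤ n, S k ω = S k ω₀) ∧ S (n + 1) ω = S n ω₀ + a • unitVec d i} := by
    rw [hset, hx.1]; rfl
  rw [hset', hset]
  unfold berwDirs at hi ⊢
  by_cases hm : x ∈ t
  · rw [if_pos hm] at hi ⊢
    rw [card_oldDirs h2']
    rw [← hx.2, mem_tail_walkHist] at hm
    refine hS.2.2.2 n (fun k => S k ω₀) ?_ i (by simpa using hi) a ha
    obtain ⟨k, hk, h⟩ := hm
    exact ⟨k, hk, by rw [h, hx.1]⟩
  · rw [if_neg hm] at hi ⊢
    rw [card_newDirs h1']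
    rw [← hx.2, mem_tail_walkHist] at hm
    refine hS.2.2.1 n (fun k => S k ω₀) ?_ i (by simpa using hi) a ha
    intro k hk h
    exact hm ⟨k, hk, by rw [← h, hx.1]⟩

theorem berwDirs_nonempty (h1 : 1 ≤ d₁) (h1' : d₁ ≤ d) (h2 : 1 ≤ d₂) (h2' : d₂ ≤ d)
    (x : Fin d → ℤ) (t : List (Fin d → ℤ)) : (berwDirs d d₁ d₂ x t).Nonempty := by
  rw [← Finset.card_pos]
  unfold berwDirs
  split_ifs
  · rw [card_oldDirs h2']; omega
  · rw [card_newDirs h1']; omega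

theorem IsBERW.setLIntegral_step [IsProbabilityMeasure P] (hS : IsBERW d d₁ d₂ P S)
    (h1 : 1 ≤ d₁) (h1' : d₁ ≤ d) (h2 : 1 ≤ d₂) (h2' : d₂ ≤ d)
    {φ : List (Fin d → ℤ) → ℝ} (hφ : ∀ l, 0 ≤ φ l) (n : ℕ) (x : Fin d → ℤ)
    (t : List (Fin d → ℤ)) :
    ∫⁻ ω in {ω | walkHist S ω n = x :: t}, ENNReal.ofReal (φ (walkHist S ω (n + 1))) ∂P
      = ENNReal.ofReal (berwOp d d₁ d₂ φ (x :: t)) * P {ω | walkHist S ω n = x :: t} := by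
  set B := {ω | walkHist S ω n = x :: t} with hB
  set I := berwDirs d d₁ d₂ x t with hI
  have hIc : 0 < I.card := (berwDirs_nonempty h1 h1' h2 h2' x t).card_pos
  have hBm : MeasurableSet B := measurableSet_walkHist_eq hS.1 n _
  let T : Finset (Fin d × ℤ) := I ×ˢ {1, -1}
  let c : Fin d × ℤ → Fin d → ℤ := fun p => x + p.2 • unitVec d p.1
  let C : Fin d × ℤ → Set Ω := fun p => B ∩ {ω | S (n + 1) ω = c p}
  have hT : ∀ p ∈ T, p.1 ∈ I ∧ (p.2 = 1 ∨ p.2 = -1) := by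
    intro p hp; simpa [T] using hp
  have hCm : ∀ p, MeasurableSet (C p) := fun p =>
    hBm.inter (hS.1 (n + 1) (measurableSet_singleton (c p)))
  have hCP : ∀ p ∈ T, P (C p) = P B / (2 * I.card) := fun p hp =>
    hS.measure_step h1' h2' n x t p.1 (hT p hp).1 p.2 (hT p hp).2
  have hdisj : Set.PairwiseDisjoint (T : Set (Fin d × ℤ)) C := by
    intro p hp q hq hpq
    refine Set.disjoint_left.2 fun ω hω hω' => hpq ?_
    have : c p = c q := hω.2.symm.trans hω'.2
    have := unitVec_injective (hT p hp).2 this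
    exact Prod.ext this.1 this.2
  have hTc : T.card = 2 * I.card := by
    simp [T, Finset.card_product, mul_comm]
  have hne : (2 * I.card : ENNReal) ≠ 0 := by
    simp [hIc.ne']
  have hnt : (2 * I.card : ENNReal) ≠ ⊤ := ENNReal.mul_ne_top (by simp) (by simp)
  have hDP : P (⋃ p ∈ T, C p) = P B := by
    rw [measure_biUnion_finset hdisj fun p _ => hCm p, Finset.sum_congr rfl hCP, Finset.sum_const,
      hTc, nsmul_eq_mul]
    push_cast
    exact ENNReal.mul_div_cancel hne hnt
  have hDB : (⋃ p ∈ T, C p) ⊆ B := Set.iUnion₂_subset fun p _ => Set.inter_subset_left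
  have hDm : MeasurableSet (⋃ p ∈ T, C p) := Finset.measurableSet_biUnion _ fun p _ => hCm p
  have hae : (⋃ p ∈ T, C p) =ᵐ[P] B :=
    ae_eq_of_subset_of_measure_ge hDB hDP.ge hDm.nullMeasurableSet (measure_ne_top P B)
  rw [← setLIntegral_congr hae, lintegral_biUnion_finset hdisj (fun p _ => hCm p)]
  have hterm : ∀ p ∈ T, ∫⁻ ω in C p, ENNReal.ofReal (φ (walkHist S ω (n + 1))) ∂P
      = ENNReal.ofReal (φ (c p :: x :: t)) * (P B / (2 * I.card)) := by
    intro p hp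
    rw [← hCP p hp, ← setLIntegral_const]
    refine setLIntegral_congr_fun (hCm p) fun ω hω => ?_
    have h3 : walkHist S ω n = x :: t := hω.1
    have h4 : S (n + 1) ω = c p := hω.2
    simp [walkHist, h3, h4]
  rw [Finset.sum_congr rfl hterm, ← Finset.sum_mul, ← ENNReal.ofReal_sum_of_nonneg fun p _ => hφ _]
  have hsum : ∑ p ∈ T, φ (c p :: x :: t) = berwOp d d₁ d₂ φ (x :: t) * (2 * I.card) := by
    have : (2 * (I.card : ℝ)) ≠ 0 := by positivity
    simp only [T, Finset.sum_product, berwOp, nbrAvg, c]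
    rw [← hI, div_mul_cancel₀ _ this]
    refine Finset.sum_congr rfl fun i _ => ?_
    rw [Finset.sum_pair (by norm_num)]
    simp [sub_eq_add_neg]
  rw [hsum, ENNReal.ofReal_mul (berwOp_nonneg hφ _), mul_assoc]
  congr 1
  have : ENNReal.ofReal (2 * (I.card : ℝ)) = 2 * (I.card : ENNReal) := by
    rw [ENNReal.ofReal_mul (by norm_num)]
    simp
  rw [this, ENNReal.mul_div_cancel hne hnt]

theorem IsBERW.lintegral_walkHist [IsProbabilityMeasure P] (hS : IsBERW d d₁ d₂ P S)
    (h1 : 1 ≤ d₁) (h1' : d₁ ≤ d) (h2 : 1 ≤ d₂) (h2' : d₂ ≤ d)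
    {φ : List (Fin d → ℤ) → ℝ} (hφ : ∀ l, 0 ≤ φ l) (n : ℕ) :
    ∫⁻ ω, ENNReal.ofReal (φ (walkHist S ω n)) ∂P = ENNReal.ofReal (berwExp d d₁ d₂ n φ) := by
  induction n generalizing φ with
  | zero =>
    have : ∀ᵐ ω ∂P, ENNReal.ofReal (φ (walkHist S ω 0)) = ENNReal.ofReal (φ [0]) := by
      filter_upwards [hS.2.1] with ω hω
      simp [walkHist, hω]
    rw [lintegral_congr_ae this]
    simp [berwExp]
  | succ n ih =>
    rw [berwExp_succ, ← ih (berwOp_nonneg hφ)]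
    have hm := measurableSet_walkHist_eq hS.1 n
    have hd : Pairwise (Function.onFun Disjoint fun l => {ω | walkHist S ω n = l}) := by
      intro l l' hl
      refine Set.disjoint_left.2 fun ω h h' => hl ?_
      exact (show walkHist S ω n = l from h).symm.trans h'
    have hU : (⋃ l, {ω | walkHist S ω n = l}) = Set.univ := by
      ext ω; simp
    rw [← setLIntegral_univ, ← hU, lintegral_iUnion hm hd, ← setLIntegral_univ
      (fun ω => ENNReal.ofReal (berwOp d d₁ d₂ φ (walkHist S ω n))), ← hU, lintegral_iUnion hm hd]
    refine tsum_congr fun l => ?_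
    have hr : ∫⁻ ω in {ω | walkHist S ω n = l},
        ENNReal.ofReal (berwOp d d₁ d₂ φ (walkHist S ω n)) ∂P
        = ENNReal.ofReal (berwOp d d₁ d₂ φ l) * P {ω | walkHist S ω n = l} := by
      rw [← setLIntegral_const]
      refine setLIntegral_congr_fun (hm l) fun ω hω => ?_
      rw [Set.mem_ofPred_eq] at hω
      simp only [hω]
    rw [hr]
    cases l with
    | nil =>
      have : {ω | walkHist S ω n = []} = ∅ := by
        ext ω
        have := walkHist_eq_cons (S := S) ω n
        simp only [Set.mem_ofPred_eq, Set.mem_empty_iff_false, iff_false]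
        intro h
        rw [h] at this
        simp at this
      simp [this]
    | cons x t => exact hS.setLIntegral_step h1 h1' h2 h2' hφ n x t

open Classical in
theorem IsBERW.measure_walkHist [IsProbabilityMeasure P] (hS : IsBERW d d₁ d₂ P S)
    (h1 : 1 ≤ d₁) (h1' : d₁ ≤ d) (h2 : 1 ≤ d₂) (h2' : d₂ ≤ d)
    (Q : List (Fin d → ℤ) → Prop) (n : ℕ) :
    P {ω | Q (walkHist S ω n)}
      = ENNReal.ofReal (berwExp d d₁ d₂ n fun l => if Q l then 1 else 0) := by
  rw [← hS.lintegral_walkHist h1 h1' h2 h2' (fun l => by split_ifs <;> norm_num)]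
  have hm : MeasurableSet {ω | Q (walkHist S ω n)} := by
    have : {ω | Q (walkHist S ω n)} = ⋃ l ∈ {l | Q l}, {ω | walkHist S ω n = l} := by
      ext ω; simp
    rw [this]
    exact MeasurableSet.biUnion (Set.to_countable _) fun l _ => measurableSet_walkHist_eq hS.1 n l
  rw [← lintegral_indicator_one hm]
  refine lintegral_congr fun ω => ?_
  by_cases h : Q (walkHist S ω n) <;> simp [Set.indicator, h]

open Classical in
theorem IsBERW.tsum_measure_le [IsProbabilityMeasure P] (hS : IsBERW d d₁ d₂ P S)
    (h1 : 1 ≤ d₁) (h1' : d₁ ≤ d) (h2 : 1 ≤ d₂) (h2' : d₂ ≤ d)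
    {Q : List (Fin d → ℤ) → Prop} {c : ℝ}
    (h : ∀ N, ∑ n ∈ Finset.range N, berwExp d d₁ d₂ n (fun l => if Q l then 1 else 0) ≤ c) :
    ∑' n, P {ω | Q (walkHist S ω n)} ≤ ENNReal.ofReal c := by
  refine ENNReal.tsum_le_of_sum_range_le fun N => ?_
  simp_rw [hS.measure_walkHist h1 h1' h2 h2' Q]
  rw [← ENNReal.ofReal_sum_of_nonneg fun n _ => berwExp_nonneg n fun l => by split_ifs <;> norm_num]
  exact ENNReal.ofReal_le_ofReal (h N)

/-- Events of finite expected number happen finitely often. -/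
theorem IsBERW.ae_finite [IsProbabilityMeasure P] (hS : IsBERW d d₁ d₂ P S)
    (h1 : 1 ≤ d₁) (h1' : d₁ ≤ d) (h2 : 1 ≤ d₂) (h2' : d₂ ≤ d)
    {Q : List (Fin d → ℤ) → Prop} {ψ : List (Fin d → ℤ) → ℝ} {a c : ℝ} (ha : 0 < a)
    (hψ : ∀ l, 0 ≤ ψ l) (hQ : ∀ l, Q l → a ≤ ψ l)
    (h : ∀ N, ∑ n ∈ Finset.range N, berwExp d d₁ d₂ n ψ ≤ c) :
    ∀ᵐ ω ∂P, {n | Q (walkHist S ω n)}.Finite := by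
  classical
  have hle : ∑' n, P {ω | Q (walkHist S ω n)} ≤ ENNReal.ofReal (a⁻¹ * c) := by
    refine hS.tsum_measure_le h1 h1' h2 h2' fun N => ?_
    refine le_trans ?_ (mul_le_mul_of_nonneg_left (h N) (by positivity))
    rw [Finset.mul_sum]
    refine Finset.sum_le_sum fun n _ => ?_
    rw [← berwExp_smul]
    refine berwExp_mono n fun x t => ?_
    simp only [Pi.smul_apply, smul_eq_mul]
    split_ifs with hq
    · have := hQ _ hq
      rw [inv_mul_eq_div, le_div_iff₀ ha]
      linarith
    · exact mul_nonneg (by positivity) (hψ _)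
  have := ae_finite_setOfPred_mem (μ := P) (s := fun n => {ω | Q (walkHist S ω n)})
    (ne_top_of_le_ne_top ENNReal.ofReal_ne_top hle)
  simpa using this

end Law

section Lyapunov

theorem rpow_neg_one_add_le {η y : ℝ} (hη : 0 < η) (hη' : η ≤ 1 / 4) (hy : |y| ≤ η) :
    (1 + y) ^ (-η) ≤ 1 - η * y + η * (1 / 2 + 6 * η) * y ^ 2 := by
  have hy1 := abs_le.1 hy
  have hpos : 0 < 1 + y := by linarith
  have h1 : |y + -y ^ 2 / 2 - Real.log (1 + y)| ≤ 2 * η * y ^ 2 := by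
    have h2 := Real.abs_log_sub_add_sum_range_le (x := -y) (by rw [abs_neg]; linarith) 2
    simp only [Finset.sum_range_succ, Finset.sum_range_zero, abs_neg, sub_neg_eq_add] at h2
    have h3 : |y| ^ (2 + 1) / (1 - |y|) ≤ 2 * η * y ^ 2 := by
      rw [div_le_iff₀ (by linarith), pow_succ, sq_abs]
      have h4 : |y| ≤ 2 * η * (1 - |y|) := by nlinarith
      calc y ^ 2 * |y| ≤ y ^ 2 * (2 * η * (1 - |y|)) := by gcongr
        _ = 2 * η * y ^ 2 * (1 - |y|) := by ring
    rw [abs_sub_comm]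
    refine le_trans (le_of_eq ?_) (h2.trans h3)
    congr 1
    norm_num
    ring
  have h1' := abs_le.1 h1
  set z := Real.log (1 + y) with hz
  have hzy : |z| ≤ 2 * |y| := by
    have hy2 : y ^ 2 ≤ |y| * (1 / 4) := by
      rw [← sq_abs, pow_two]
      exact mul_le_mul_of_nonneg_left (by linarith) (abs_nonneg y)
    have := abs_nonneg y
    have h5 : 2 * η * y ^ 2 ≤ 2 * (1 / 4) * (|y| * (1 / 4)) := by gcongr
    rw [abs_le]
    constructor <;> nlinarith [le_abs_self y, neg_abs_le y]
  have hz2 : z ^ 2 ≤ 4 * y ^ 2 := by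
    rw [← sq_abs z, ← sq_abs y]
    nlinarith [abs_nonneg z, abs_nonneg y]
  have hexp := Real.abs_exp_sub_one_sub_id_le (x := -η * z) (by
    rw [abs_mul, abs_neg, abs_of_pos hη]
    nlinarith [abs_nonneg z, abs_nonneg y])
  rw [Real.rpow_def_of_pos hpos, ← hz, mul_comm z]
  have h6 := (abs_le.1 hexp).2
  have h7 : η * (y - y ^ 2 / 2 - 2 * η * y ^ 2) ≤ η * z :=
    mul_le_mul_of_nonneg_left (by linarith) hη.le
  have h8 : (-η * z) ^ 2 ≤ η ^ 2 * (4 * y ^ 2) := by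
    rw [mul_pow, neg_sq]; gcongr
  nlinarith

variable {d : ℕ}

/-- The squared Euclidean norm of the coordinates of `x` in `J`. -/
noncomputable def sqSum (J : Finset (Fin d)) (x : Fin d → ℤ) : ℝ := ∑ i ∈ J, (x i : ℝ) ^ 2

variable {J : Finset (Fin d)} {x : Fin d → ℤ}

theorem sqSum_nonneg : 0 ≤ sqSum J x := Finset.sum_nonneg fun _ _ => sq_nonneg _

theorem sqSum_add (i : Fin d) :
    sqSum J (x + unitVec d i) = sqSum J x + if i ∈ J then 1 + 2 * (x i : ℝ) else 0 := by
  unfold sqSum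
  have : ∀ j ∈ J, (((x + unitVec d i) j : ℤ) : ℝ) ^ 2
      = (x j : ℝ) ^ 2 + if i = j then 1 + 2 * (x j : ℝ) else 0 := by
    intro j _
    by_cases h : i = j
    · subst h; simp [unitVec]; ring
    · simp [unitVec, h, Ne.symm h]
  rw [Finset.sum_congr rfl this, Finset.sum_add_distrib, Finset.sum_ite_eq]

theorem sqSum_sub (i : Fin d) :
    sqSum J (x - unitVec d i) = sqSum J x + if i ∈ J then 1 - 2 * (x i : ℝ) else 0 := by
  unfold sqSum
  have : ∀ j ∈ J, (((x - unitVec d i) j : ℤ) : ℝ) ^ 2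
      = (x j : ℝ) ^ 2 + if i = j then 1 - 2 * (x j : ℝ) else 0 := by
    intro j _
    by_cases h : i = j
    · subst h; simp [unitVec]; ring
    · simp [unitVec, h, Ne.symm h]
  rw [Finset.sum_congr rfl this, Finset.sum_add_distrib, Finset.sum_ite_eq]

/-- The shifted squared norm used in the Lyapunov functions. -/
noncomputable def lyapBase (J : Finset (Fin d)) (η : ℝ) (x : Fin d → ℤ) : ℝ :=
  sqSum J x + (d + 2 / η ^ 2)

/-- The Lyapunov function `(|x|² + C) ^ (-η)`. -/
noncomputable def lyapFun (J : Finset (Fin d)) (η : ℝ) (x : Fin d → ℤ) : ℝ :=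
  lyapBase J η x ^ (-η)

/-- The drift scale `(|x|² + C) ^ (-η - 1)`. -/
noncomputable def lyapDrift (J : Finset (Fin d)) (η : ℝ) (x : Fin d → ℤ) : ℝ :=
  lyapFun J η x / lyapBase J η x

variable {η : ℝ}

theorem lyapBase_pos (hη : 0 < η) : 0 < lyapBase J η x := by
  have := sqSum_nonneg (J := J) (x := x)
  unfold lyapBase
  positivity

theorem lyapFun_pos (hη : 0 < η) : 0 < lyapFun J η x := Real.rpow_pos_of_pos (lyapBase_pos hη) _

theorem lyapDrift_pos (hη : 0 < η) : 0 < lyapDrift J η x :=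
  div_pos (lyapFun_pos hη) (lyapBase_pos hη)

theorem abs_increment_le (hη : 0 < η) (hη' : η ≤ 1 / 4) {i : Fin d} (hi : i ∈ J) :
    1 + 2 * |(x i : ℝ)| ≤ η * lyapBase J η x := by
  have h1 : (x i : ℝ) ^ 2 ≤ sqSum J x :=
    Finset.single_le_sum (f := fun i => (x i : ℝ) ^ 2) (fun _ _ => sq_nonneg _) hi
  have h2 : η * (2 / η ^ 2) = 2 / η := by field_simp
  have h3 : 4 ≤ 1 / η := by rw [le_div_iff₀ hη]; linarith
  have h4 : 2 * |(x i : ℝ)| ≤ η * (x i : ℝ) ^ 2 + 1 / η := by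
    have h5 : η * (x i : ℝ) ^ 2 + 1 / η - 2 * |(x i : ℝ)| = (η * |(x i : ℝ)| - 1) ^ 2 / η := by
      rw [← sq_abs]; field_simp; ring
    have h6 : 0 ≤ (η * |(x i : ℝ)| - 1) ^ 2 / η := by positivity
    linarith
  have h7 : (0 : ℝ) ≤ η * d := by positivity
  have h8 : 2 / η = 1 / η + 1 / η := by ring
  unfold lyapBase
  nlinarith

theorem lyapFun_shift (hη : 0 < η) (hη' : η ≤ 1 / 4) {x' : Fin d → ℤ} {δ : ℝ}
    (h : sqSum J x' = sqSum J x + δ) (hδ : |δ| ≤ η * lyapBase J η x) :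
    lyapFun J η x' ≤ lyapFun J η x * (1 - η * (δ / lyapBase J η x)
      + η * (1 / 2 + 6 * η) * (δ / lyapBase J η x) ^ 2) := by
  have hb := lyapBase_pos (J := J) (x := x) hη
  have hy : |δ / lyapBase J η x| ≤ η := by
    rw [abs_div, abs_of_pos hb, div_le_iff₀ hb]; exact hδ
  have h1 : lyapBase J η x' = lyapBase J η x * (1 + δ / lyapBase J η x) := by
    have : lyapBase J η x' = lyapBase J η x + δ := by unfold lyapBase; rw [h]; ring
    rw [this]; field_simp
  have h2 : 0 ≤ 1 + δ / lyapBase J η x := by linarith [(abs_le.1 hy).1]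
  have h3 : lyapFun J η x' = lyapFun J η x * (1 + δ / lyapBase J η x) ^ (-η) := by
    unfold lyapFun
    rw [h1, Real.mul_rpow hb.le h2]
  rw [h3]
  exact mul_le_mul_of_nonneg_left (rpow_neg_one_add_le hη hη' hy) (lyapFun_pos hη).le

theorem abs_one_add_two_mul_le (a : ℝ) : |1 + 2 * a| ≤ 1 + 2 * |a| := by
  have := abs_add_le 1 (2 * a)
  rwa [abs_mul, abs_one, abs_two] at this

theorem abs_one_sub_two_mul_le (a : ℝ) : |1 - 2 * a| ≤ 1 + 2 * |a| := by
  simpa [sub_eq_add_neg] using abs_one_add_two_mul_le (-a)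

theorem lyapFun_pair (hη : 0 < η) (hη' : η ≤ 1 / 4) (i : Fin d) :
    lyapFun J η (x + unitVec d i) + lyapFun J η (x - unitVec d i) ≤
      2 * lyapFun J η x * (1 - if i ∈ J then η / lyapBase J η x
        - η * (1 / 2 + 6 * η) * (1 + 4 * (x i : ℝ) ^ 2) / lyapBase J η x ^ 2 else 0) := by
  have hb := lyapBase_pos (J := J) (x := x) hη
  by_cases hi : i ∈ J
  · have h0 := abs_increment_le (x := x) hη hη' hi
    have h1 := lyapFun_shift hη hη' (x := x) (x' := x + unitVec d i) (by rw [sqSum_add, if_pos hi])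
      ((abs_one_add_two_mul_le _).trans h0)
    have h2 := lyapFun_shift hη hη' (x := x) (x' := x - unitVec d i) (by rw [sqSum_sub, if_pos hi])
      ((abs_one_sub_two_mul_le _).trans h0)
    rw [if_pos hi]
    refine (add_le_add h1 h2).trans (le_of_eq ?_)
    field_simp
    ring
  · rw [if_neg hi]
    unfold lyapFun lyapBase
    simp only [sqSum_add, sqSum_sub, if_neg hi, add_zero]
    refine le_of_eq ?_
    ring

/-- One-step drift of the Lyapunov function in the directions `I`. -/
theorem nbrAvg_lyapFun_le (hη : 0 < η) (hη' : η ≤ 1 / 4) {I : Finset (Fin d)}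
    (hI : I.Nonempty) : nbrAvg I (lyapFun J η) x ≤ lyapFun J η x -
      η * ((I ∩ J).card - 2 - 24 * η) / I.card * lyapDrift J η x := by
  have hb := lyapBase_pos (J := J) (x := x) hη
  have hf := lyapFun_pos (J := J) (x := x) hη
  have hm : (0 : ℝ) < I.card := by exact_mod_cast hI.card_pos
  unfold nbrAvg lyapDrift
  rw [div_le_iff₀ (by positivity)]
  refine (Finset.sum_le_sum fun i _ => lyapFun_pair (x := x) (J := J) hη hη' i).trans ?_
  rw [← Finset.mul_sum, Finset.sum_sub_distrib, ← Finset.sum_filter, Finset.sum_sub_distrib,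
    Finset.filter_mem_eq_inter]
  simp only [Finset.sum_const, nsmul_eq_mul, mul_one]
  rw [← Finset.sum_div, ← Finset.mul_sum, Finset.sum_add_distrib, ← Finset.mul_sum]
  simp only [Finset.sum_const, nsmul_eq_mul, mul_one]
  set k : ℝ := ((I ∩ J).card : ℝ)
  set b := lyapBase J η x with hbdef
  have hk : k + 4 * ∑ i ∈ I ∩ J, (x i : ℝ) ^ 2 ≤ 4 * b := by
    have h1 : ∑ i ∈ I ∩ J, (x i : ℝ) ^ 2 ≤ sqSum J x :=
      Finset.sum_le_sum_of_subset_of_nonneg Finset.inter_subset_right fun _ _ _ => sq_nonneg _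
    have h2 : k ≤ d := by
      have := Finset.card_le_univ (I ∩ J)
      simp only [Fintype.card_fin] at this
      exact Nat.cast_le.2 this
    have h3 : (0 : ℝ) ≤ 2 / η ^ 2 := by positivity
    have h4 : (0 : ℝ) ≤ d := by positivity
    rw [hbdef]
    unfold lyapBase
    linarith
  have h5 : η * (1 / 2 + 6 * η) * (k + 4 * ∑ i ∈ I ∩ J, (x i : ℝ) ^ 2) / b ^ 2 ≤
      η * (1 / 2 + 6 * η) * 4 / b := by
    rw [div_le_div_iff₀ (by positivity) hb]
    have : 0 ≤ η * (1 / 2 + 6 * η) * b := by positivity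
    nlinarith
  have h6 : (lyapFun J η x - η * (k - 2 - 24 * η) / I.card * (lyapFun J η x / b)) * (2 * I.card)
      = 2 * lyapFun J η x * (I.card - (k * (η / b) - η * (1 / 2 + 6 * η) * 4 / b)) := by
    field_simp
    ring
  rw [h6]
  gcongr

theorem nbrAvg_lyapFun_of_disjoint {I : Finset (Fin d)}
    (hI : I.Nonempty) (h : Disjoint I J) : nbrAvg I (lyapFun J η) x = lyapFun J η x := by
  rw [← nbrAvg_const (x := x) hI (lyapFun J η x)]
  unfold nbrAvg lyapFun lyapBase
  congr 1
  refine Finset.sum_congr rfl fun i hi => ?_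
  have := Finset.disjoint_left.1 h hi
  simp only [sqSum_add, sqSum_sub, if_neg this, add_zero]

theorem lyapDrift_shift (hη : 0 < η) (hη' : η ≤ 1 / 4) {x' : Fin d → ℤ} {δ : ℝ}
    (h : sqSum J x' = sqSum J x + δ) (hδ : |δ| ≤ η * lyapBase J η x) :
    lyapDrift J η x / 4 ≤ lyapDrift J η x' := by
  have hb := lyapBase_pos (J := J) (x := x) hη
  have hb' := lyapBase_pos (J := J) (x := x') hη
  have h1 : lyapBase J η x' ≤ 2 * lyapBase J η x := by
    have : lyapBase J η x' = lyapBase J η x + δ := by unfold lyapBase; rw [h]; ring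
    nlinarith [le_abs_self δ]
  have h2 : lyapFun J η x / 2 ≤ lyapFun J η x' := by
    unfold lyapFun
    have h3 : (2 * lyapBase J η x) ^ (-η) ≤ lyapBase J η x' ^ (-η) :=
      Real.rpow_le_rpow_of_nonpos hb' h1 (by linarith)
    rw [Real.mul_rpow (by norm_num) hb.le] at h3
    have h4 : (2 : ℝ) ^ (-1 : ℝ) ≤ 2 ^ (-η) :=
      Real.rpow_le_rpow_of_exponent_le (by norm_num) (by linarith)
    rw [Real.rpow_neg_one] at h4
    have := mul_le_mul_of_nonneg_right h4 (Real.rpow_nonneg hb.le (-η))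
    linarith
  unfold lyapDrift
  rw [div_div, div_le_div_iff₀ (by positivity) hb']
  have := lyapFun_pos (J := J) (x := x) hη
  nlinarith

theorem lyapDrift_le_add (hη : 0 < η) (hη' : η ≤ 1 / 4) (i : Fin d) :
    lyapDrift J η x / 4 ≤ lyapDrift J η (x + unitVec d i) := by
  refine lyapDrift_shift hη hη' (sqSum_add i) ?_
  split_ifs with hi
  · exact (abs_one_add_two_mul_le _).trans (abs_increment_le hη hη' hi)
  · simpa using (mul_pos hη (lyapBase_pos (J := J) (x := x) hη)).le

theorem lyapDrift_le_sub (hη : 0 < η) (hη' : η ≤ 1 / 4) (i : Fin d) :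
    lyapDrift J η x / 4 ≤ lyapDrift J η (x - unitVec d i) := by
  refine lyapDrift_shift hη hη' (sqSum_sub i) ?_
  split_ifs with hi
  · exact (abs_one_sub_two_mul_le _).trans (abs_increment_le hη hη' hi)
  · simpa using (mul_pos hη (lyapBase_pos (J := J) (x := x) hη)).le

end Lyapunov

section Cases

variable {d d₁ d₂ : ℕ}

/-- The value of `g` at the current position, on the event that it is an old site. -/
def oldPart (g : (Fin d → ℤ) → ℝ) : List (Fin d → ℤ) → ℝ
  | [] => 0
  | x :: t => if x ∈ t then g x else 0

/-- The value of `g` at the current position, on the event that it is a new site. -/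
def newPart (g : (Fin d → ℤ) → ℝ) : List (Fin d → ℤ) → ℝ
  | [] => 0
  | x :: t => if x ∈ t then 0 else g x

variable {g : (Fin d → ℤ) → ℝ}

theorem oldPart_nonneg (h : ∀ x, 0 ≤ g x) (l : List (Fin d → ℤ)) : 0 ≤ oldPart g l := by
  cases l with
  | nil => exact le_rfl
  | cons x t => simp only [oldPart]; split_ifs <;> simp [h]

theorem newPart_nonneg (h : ∀ x, 0 ≤ g x) (l : List (Fin d → ℤ)) : 0 ≤ newPart g l := by
  cases l with
  | nil => exact le_rfl
  | cons x t => simp only [newPart]; split_ifs <;> simp [h]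

theorem unitVec_backtrack {φ : (Fin d → ℤ) → ℝ} (h : ∀ y, 0 ≤ φ y) {I : Finset (Fin d)}
    {x : Fin d → ℤ} {i : Fin d} (hi : i ∈ I) :
    φ (x + unitVec d i) / (2 * I.card) ≤ nbrAvg I φ x ∧
      φ (x - unitVec d i) / (2 * I.card) ≤ nbrAvg I φ x := by
  have h1 := Finset.single_le_sum (f := fun i => φ (x + unitVec d i) + φ (x - unitVec d i))
    (fun j _ => add_nonneg (h _) (h _)) hi
  unfold nbrAvg
  constructor <;> gcongr
  · exact (le_add_of_nonneg_right (h _)).trans h1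
  · exact (le_add_of_nonneg_left (h _)).trans h1

/-- From a new site, the walk stands on an old site within two steps with positive probability. -/
theorem newPart_le_berwOp (h1 : 1 ≤ d₁) (h1' : d₁ ≤ d)
    (hg : ∀ x, 0 ≤ g x) (hadd : ∀ x i, g x / 4 ≤ g (x + unitVec d i))
    (hsub : ∀ x i, g x / 4 ≤ g (x - unitVec d i)) (x : Fin d → ℤ) (t : List (Fin d → ℤ)) :
    newPart g (x :: t) ≤ (8 * d : ℝ) * berwOp d d₁ d₂
      (oldPart g + berwOp d d₁ d₂ (oldPart g)) (x :: t) := by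
  have hd : (1 : ℝ) ≤ d := by exact_mod_cast h1.trans h1'
  have hnn : ∀ l, 0 ≤ (oldPart g + berwOp d d₁ d₂ (oldPart g)) l := fun l =>
    add_nonneg (oldPart_nonneg hg l) (berwOp_nonneg (oldPart_nonneg hg) l)
  simp only [newPart]
  split_ifs with hx
  · exact mul_nonneg (by positivity) (berwOp_nonneg hnn _)
  have hne : (Finset.univ.filter (fun i : Fin d => i.1 < d₁)).Nonempty := by
    rw [← Finset.card_pos, card_newDirs h1']; omega
  have hdirs : ∀ s : List (Fin d → ℤ), ∀ y, y ∉ s →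
      berwDirs d d₁ d₂ y s = Finset.univ.filter (fun i => i.1 < d₁) := by
    intro s y hy; simp [berwDirs, hy]
  have key : ∀ i ∈ Finset.univ.filter (fun i : Fin d => i.1 < d₁), ∀ y,
      (y = x + unitVec d i ∨ y = x - unitVec d i) →
      g x / (8 * d) ≤ (oldPart g + berwOp d d₁ d₂ (oldPart g)) (y :: x :: t) := by
    intro i hi y hy
    have hgy : g x / 4 ≤ g y := by
      rcases hy with rfl | rfl
      · exact hadd x i
      · exact hsub x i
    by_cases hm : y ∈ x :: t
    · have e1 : oldPart g (y :: x :: t) = g y := by simp only [oldPart, if_pos hm]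
      have e2 := berwOp_nonneg (d₁ := d₁) (d₂ := d₂) (oldPart_nonneg hg) (y :: x :: t)
      rw [Pi.add_apply, e1]
      have : g x / (8 * d) ≤ g x / 4 := by
        apply div_le_div_of_nonneg_left (hg x) <;> linarith
      linarith
    · have e1 : berwOp d d₁ d₂ (oldPart g) (y :: x :: t) =
          nbrAvg (Finset.univ.filter (fun i => i.1 < d₁)) (fun z => oldPart g (z :: y :: x :: t)) y := by
        rw [berwOp_cons, hdirs _ _ hm]
      have e2 := unitVec_backtrack (φ := fun z => oldPart g (z :: y :: x :: t))
        (fun z => oldPart_nonneg hg _) (x := y) hi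
      have e3 : oldPart g (x :: y :: x :: t) = g x := by simp [oldPart]
      have e4 : g x / (2 * d₁) ≤ berwOp d d₁ d₂ (oldPart g) (y :: x :: t) := by
        rw [e1]
        rw [card_newDirs h1'] at e2
        rcases hy with rfl | rfl
        · have := e2.2
          rwa [add_sub_cancel_right, e3] at this
        · have := e2.1
          rwa [sub_add_cancel, e3] at this
      have e5 := oldPart_nonneg hg (y :: x :: t)
      rw [Pi.add_apply]
      have hd1 : (1 : ℝ) ≤ d₁ := by exact_mod_cast h1
      have hd2 : (d₁ : ℝ) ≤ d := by exact_mod_cast h1'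
      have : g x / (8 * d) ≤ g x / (2 * d₁) := by
        apply div_le_div_of_nonneg_left (hg x) <;> linarith
      linarith
  have hconst := nbrAvg_const (x := x) hne (g x / (8 * d))
  have : g x / (8 * d) ≤ berwOp d d₁ d₂ (oldPart g + berwOp d d₁ d₂ (oldPart g)) (x :: t) := by
    rw [← hconst, berwOp_cons, hdirs _ _ hx]
    exact nbrAvg_mono fun i hi => add_le_add (key i hi _ (Or.inl rfl)) (key i hi _ (Or.inr rfl))
  rw [div_le_iff₀ (by positivity)] at this
  linarith

variable {Ω : Type*} [MeasurableSpace Ω] {P : Measure Ω} [IsProbabilityMeasure P]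
  {S : ℕ → Ω → Fin d → ℤ}

/-- Transience when, in the coordinates `J`, the walk is at least three-dimensional at old sites
and not one-dimensional at new sites. -/
theorem IsBERW.transient_of_old (hS : IsBERW d d₁ d₂ P S)
    (h1 : 1 ≤ d₁) (h1' : d₁ ≤ d) (h2 : 1 ≤ d₂) (h2' : d₂ ≤ d) (J : Finset (Fin d))
    (hnew : Disjoint (Finset.univ.filter (fun i : Fin d => i.1 < d₁)) J ∨
      2 ≤ (Finset.univ.filter (fun i : Fin d => i.1 < d₁) ∩ J).card)
    (hold : 3 ≤ (Finset.univ.filter (fun i : Fin d => d - d₂ ≤ i.1) ∩ J).card) :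
    IsTransientWalk d P S := by
  have hd : (1 : ℝ) ≤ d := by exact_mod_cast h1.trans h1'
  obtain ⟨η, hηdef⟩ : ∃ η : ℝ, η = 1 / (1600 * d ^ 2) := ⟨_, rfl⟩
  have hη : 0 < η := by rw [hηdef]; positivity
  have hηd : 1600 * η * d ^ 2 = 1 := by rw [hηdef]; field_simp
  have hη' : η ≤ 1 / 1600 := by
    rw [hηdef]
    exact one_div_le_one_div_of_le (by norm_num) (by nlinarith)
  have hη4 : η ≤ 1 / 4 := by linarith
  set w := lyapDrift J η with hw
  have hw0 : ∀ x, 0 ≤ w x := fun x => (lyapDrift_pos hη).le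
  have hbase : ∀ x, 1 ≤ lyapBase J η x := by
    intro x
    have := sqSum_nonneg (J := J) (x := x)
    have : (0 : ℝ) ≤ 2 / η ^ 2 := by positivity
    unfold lyapBase; linarith
  have hw1 : ∀ x, w x ≤ 1 := by
    intro x
    have e1 : lyapFun J η x ≤ 1 := Real.rpow_le_one_of_one_le_of_nonpos (hbase x) (by linarith)
    rw [hw]
    unfold lyapDrift
    rw [div_le_one (lyapBase_pos hη)]
    linarith [hbase x]
  have hnn : ∀ l : List (Fin d → ℤ), 0 ≤ lyapFun J η (l.headD 0) := fun l => (lyapFun_pos hη).le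
  have hdrift : ∀ (x : Fin d → ℤ) (t : List (Fin d → ℤ)),
      berwOp d d₁ d₂ (fun l => lyapFun J η (l.headD 0)) (x :: t)
      + ((η / (2 * d)) • oldPart w) (x :: t) ≤ lyapFun J η ((x :: t).headD 0)
      + ((24 * η ^ 2) • newPart w) (x :: t) := by
    intro x t
    have hwx := hw0 x
    simp only [Pi.smul_apply, smul_eq_mul, oldPart, newPart, berwOp_cons, List.headD_cons]
    have hI := berwDirs_nonempty h1 h1' h2 h2' x t
    have havg := nbrAvg_lyapFun_le (J := J) (x := x) hη hη4 hI
    rw [← hw] at havg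
    split_ifs with hx
    · have hI2 : berwDirs d d₁ d₂ x t = Finset.univ.filter (fun i => d - d₂ ≤ i.1) := by
        simp [berwDirs, hx]
      rw [hI2] at havg ⊢
      rw [card_oldDirs h2'] at havg
      have hk : (3 : ℝ) ≤ ((Finset.univ.filter (fun i : Fin d => d - d₂ ≤ i.1) ∩ J).card : ℝ) := by
        exact_mod_cast hold
      have hd2 : (1 : ℝ) ≤ d₂ := by exact_mod_cast h2
      have hd2' : (d₂ : ℝ) ≤ d := by exact_mod_cast h2'
      have : η / (2 * d) ≤ η * (((Finset.univ.filter (fun i : Fin d => d - d₂ ≤ i.1) ∩ J).card : ℝ)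
          - 2 - 24 * η) / d₂ := by
        rw [div_le_div_iff₀ (by positivity) (by positivity)]
        have e : η * (1 / 2) ≤ η * (((Finset.univ.filter (fun i : Fin d => d - d₂ ≤ i.1) ∩ J).card : ℝ)
          - 2 - 24 * η) := mul_le_mul_of_nonneg_left (by linarith) hη.le
        nlinarith
      have := mul_le_mul_of_nonneg_right this hwx
      simp only [mul_zero, add_zero]
      linarith
    · have hI2 : berwDirs d d₁ d₂ x t = Finset.univ.filter (fun i => i.1 < d₁) := by
        simp [berwDirs, hx]
      simp only [mul_zero, add_zero]
      rcases hnew with hnew | hnew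
      · rw [hI2, nbrAvg_lyapFun_of_disjoint (hI2 ▸ hI) hnew]
        have : 0 ≤ 24 * η ^ 2 * w x := by positivity
        linarith
      · rw [hI2] at havg ⊢
        rw [card_newDirs h1'] at havg
        have hk : (2 : ℝ) ≤ ((Finset.univ.filter (fun i : Fin d => i.1 < d₁) ∩ J).card : ℝ) := by
          exact_mod_cast hnew
        have hd1 : (1 : ℝ) ≤ d₁ := by exact_mod_cast h1
        have : -(24 * η ^ 2) ≤ η * (((Finset.univ.filter (fun i : Fin d => i.1 < d₁) ∩ J).card : ℝ)
          - 2 - 24 * η) / d₁ := by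
          rw [le_div_iff₀ (by positivity)]
          nlinarith
        have := mul_le_mul_of_nonneg_right this hwx
        linarith
  set T : ℕ → ℝ := fun N => ∑ n ∈ Finset.range N, berwExp d d₁ d₂ n (oldPart w) with hT
  set W : ℕ → ℝ := fun N => ∑ n ∈ Finset.range N, berwExp d d₁ d₂ n (newPart w) with hW
  have hO0 : ∀ n, 0 ≤ berwExp d d₁ d₂ n (oldPart w) := fun n =>
    berwExp_nonneg n (oldPart_nonneg hw0)
  have hO1 : ∀ n, berwExp d d₁ d₂ n (oldPart w) ≤ 1 := by
    intro n
    have e1 : berwExp d d₁ d₂ n (fun _ => (1 : ℝ)) ≤ 1 := by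
      have := berwExp_drift (d₁ := d₁) (d₂ := d₂) (φ := fun _ : List (Fin d → ℤ) => (1 : ℝ))
        (ψ := (0 : ℝ) • fun _ => 1) (ξ := (0 : ℝ) • fun _ => 1) (fun x t => by
          simp [berwOp_cons, nbrAvg_const (berwDirs_nonempty h1 h1' h2 h2' x t)]) n
      simpa [berwExp_smul] using this
    refine (berwExp_mono n fun x t => ?_).trans e1
    simp only [oldPart]
    split_ifs
    · exact hw1 x
    · norm_num
  have hWT : ∀ N, W N ≤ 8 * d * (2 * T N + 3) := by
    intro N
    have e1 : ∀ n, berwExp d d₁ d₂ n (newPart w) ≤ 8 * d * (berwExp d d₁ d₂ (n + 1) (oldPart w)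
        + berwExp d d₁ d₂ (n + 2) (oldPart w)) := by
      intro n
      have := berwExp_mono (d₁ := d₁) (d₂ := d₂) (ψ := (8 * d : ℝ) • berwOp d d₁ d₂
        (oldPart w + berwOp d d₁ d₂ (oldPart w))) n (newPart_le_berwOp h1 h1' hw0
        (fun x i => lyapDrift_le_add hη hη4 i) (fun x i => lyapDrift_le_sub hη hη4 i))
      rwa [berwExp_smul, ← berwExp_succ, berwExp_add, ← berwExp_succ] at this
    have e2 : ∑ n ∈ Finset.range N, berwExp d d₁ d₂ (n + 1) (oldPart w) ≤ T N + 1 := by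
      have f1 := Finset.sum_range_succ' (fun n => berwExp d d₁ d₂ n (oldPart w)) N
      have f2 := Finset.sum_range_succ (fun n => berwExp d d₁ d₂ n (oldPart w)) N
      have := hO0 0
      have := hO1 N
      simp only [hT]
      linarith
    have e3 : ∑ n ∈ Finset.range N, berwExp d d₁ d₂ (n + 2) (oldPart w) ≤ T N + 2 := by
      have f1 : ∑ n ∈ Finset.range (N + 1), berwExp d d₁ d₂ (n + 1) (oldPart w) =
          ∑ n ∈ Finset.range N, berwExp d d₁ d₂ (n + 2) (oldPart w) +
            berwExp d d₁ d₂ 1 (oldPart w) :=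
        Finset.sum_range_succ' (fun n => berwExp d d₁ d₂ (n + 1) (oldPart w)) N
      have f2 := Finset.sum_range_succ (fun n => berwExp d d₁ d₂ (n + 1) (oldPart w)) N
      have := hO0 1
      have := hO1 (N + 1)
      linarith
    have e4 := Finset.sum_le_sum fun n (_ : n ∈ Finset.range N) => e1 n
    rw [← Finset.mul_sum, Finset.sum_add_distrib] at e4
    refine e4.trans (mul_le_mul_of_nonneg_left (by linarith) (by positivity))
  have hf0 : lyapFun J η 0 ≤ 1 := Real.rpow_le_one_of_one_le_of_nonpos (hbase 0) (by linarith)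
  have hTb : ∀ N, T N ≤ 4 * d / η * (1 + 576 * η ^ 2 * d) := by
    intro N
    have e1 := berwExp_drift hdrift N
    simp only [berwExp_smul, ← Finset.mul_sum] at e1
    have e2 : 0 ≤ berwExp d d₁ d₂ N (fun l => lyapFun J η (l.headD 0)) := berwExp_nonneg N hnn
    have e3 := mul_le_mul_of_nonneg_left (hWT N) (show 0 ≤ 24 * η ^ 2 by positivity)
    have hT0 : 0 ≤ T N := Finset.sum_nonneg fun n _ => hO0 n
    have e4 : η / (2 * d) * T N ≤ 1 + 24 * η ^ 2 * (8 * d * (2 * T N + 3)) := by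
      have e0 : lyapFun J η (([0] : List (Fin d → ℤ)).headD 0) ≤ 1 := hf0
      linarith
    have e5 : 24 * η ^ 2 * (8 * d * 2) * T N ≤ η / (4 * d) * T N := by
      refine mul_le_mul_of_nonneg_right ?_ hT0
      rw [le_div_iff₀ (by positivity)]
      have : η * (1600 * η * d ^ 2) = η := by rw [hηd, mul_one]
      nlinarith
    have e6 : η / (2 * d) = η / (4 * d) + η / (4 * d) := by field_simp; norm_num
    have e7 : η / (4 * d) * T N ≤ 1 + 576 * η ^ 2 * d := by
      rw [e6] at e4
      linarith
    have e8 : T N = 4 * d / η * (η / (4 * d) * T N) := by field_simp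
    rw [e8]
    exact mul_le_mul_of_nonneg_left e7 (by positivity)
  have hall : ∀ N, ∑ n ∈ Finset.range N, berwExp d d₁ d₂ n (oldPart w + newPart w) ≤
      4 * d / η * (1 + 576 * η ^ 2 * d) +
        8 * d * (2 * (4 * d / η * (1 + 576 * η ^ 2 * d)) + 3) := by
    intro N
    simp only [berwExp_add, Finset.sum_add_distrib]
    refine add_le_add (hTb N) ((hWT N).trans ?_)
    have := hTb N
    gcongr
  refine ae_all_iff.2 fun x => ?_
  have := hS.ae_finite h1 h1' h2 h2' (Q := fun l => ∃ t, l = x :: t)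
    (ψ := oldPart w + newPart w) (lyapDrift_pos (J := J) (x := x) hη)
    (fun l => add_nonneg (oldPart_nonneg hw0 l) (newPart_nonneg hw0 l)) (by
      rintro l ⟨t, rfl⟩
      simp only [Pi.add_apply, oldPart, newPart]
      split_ifs <;> simp [hw]) hall
  filter_upwards [this] with ω hω
  refine hω.subset fun n hn => ?_
  rw [Set.mem_ofPred_eq] at hn ⊢
  exact ⟨_, by rw [← hn]; exact walkHist_eq_cons ω n⟩

end Cases

section Unbounded

variable {d d₁ d₂ : ℕ}

theorem nbrAvg_sqSum {I J : Finset (Fin d)} (hI : I.Nonempty) (x : Fin d → ℤ) :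
    nbrAvg I (sqSum J) x = sqSum J x + (I ∩ J).card / I.card := by
  have hI0 : (I.card : ℝ) ≠ 0 := by exact_mod_cast hI.card_pos.ne'
  unfold nbrAvg
  have : ∀ i ∈ I, sqSum J (x + unitVec d i) + sqSum J (x - unitVec d i) =
      2 * sqSum J x + 2 * if i ∈ J then 1 else 0 := by
    intro i _
    rw [sqSum_add, sqSum_sub]
    split_ifs <;> ring
  rw [Finset.sum_congr rfl this, Finset.sum_add_distrib, ← Finset.mul_sum, ← Finset.mul_sum,
    Finset.sum_boole, Finset.sum_const, nsmul_eq_mul, Finset.filter_mem_eq_inter]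
  field_simp

theorem abs_add_unitVec_le (x : Fin d → ℤ) (i c : Fin d) :
    |(x + unitVec d i) c| ≤ |x c| + 1 ∧ |(x - unitVec d i) c| ≤ |x c| + 1 := by
  simp only [Pi.add_apply, Pi.sub_apply, unitVec]
  split_ifs <;> constructor <;> grind

variable {Ω : Type*} [MeasurableSpace Ω] {P : Measure Ω} [IsProbabilityMeasure P]
  {S : ℕ → Ω → Fin d → ℤ}

/-- Almost surely, every step is along one of the available directions. -/
theorem IsBERW.ae_step (hS : IsBERW d d₁ d₂ P S)
    (h1 : 1 ≤ d₁) (h1' : d₁ ≤ d) (h2 : 1 ≤ d₂) (h2' : d₂ ≤ d) :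
    ∀ᵐ ω ∂P, ∀ n, ∃ i ∈ berwDirs d d₁ d₂ (S n ω) (walkHist S ω n).tail,
      S (n + 1) ω = S n ω + unitVec d i ∨ S (n + 1) ω = S n ω - unitVec d i := by
  classical
  refine ae_all_iff.2 fun n => ?_
  have := hS.measure_walkHist h1 h1' h2 h2' (fun l => ∃ y x t, l = y :: x :: t ∧
    ¬ ∃ i ∈ berwDirs d d₁ d₂ x t, y = x + unitVec d i ∨ y = x - unitVec d i) (n + 1)
  rw [berwExp_succ] at this
  have h0 : berwExp d d₁ d₂ n (berwOp d d₁ d₂ fun l => if ∃ y x t, l = y :: x :: t ∧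
    ¬ ∃ i ∈ berwDirs d d₁ d₂ x t, y = x + unitVec d i ∨ y = x - unitVec d i then 1 else 0) ≤
      berwExp d d₁ d₂ n ((0 : ℝ) • 0) := by
    refine berwExp_mono n fun x t => ?_
    rw [berwOp_cons]
    refine (nbrAvg_mono (g' := fun _ => 0) fun i hi => ?_).trans ?_
    · rw [if_neg, if_neg]
      · rintro ⟨y', x', t', h, h'⟩
        simp only [List.cons.injEq] at h
        obtain ⟨rfl, rfl, rfl⟩ := h
        exact h' ⟨i, hi, Or.inr rfl⟩
      · rintro ⟨y', x', t', h, h'⟩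
        simp only [List.cons.injEq] at h
        obtain ⟨rfl, rfl, rfl⟩ := h
        exact h' ⟨i, hi, Or.inl rfl⟩
    · rw [nbrAvg_const (berwDirs_nonempty h1 h1' h2 h2' x t)]; simp
  rw [berwExp_smul, zero_mul] at h0
  rw [ENNReal.ofReal_of_nonpos h0] at this
  have h3 := measure_eq_zero_iff_ae_notMem.1 this
  filter_upwards [h3] with ω hω
  by_contra hcon
  refine hω ⟨S (n + 1) ω, S n ω, (walkHist S ω n).tail, ?_, hcon⟩
  rw [← walkHist_eq_cons]
  rfl

/-- A coordinate along which the walk moves both at new and at old sites is unbounded. -/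
theorem IsBERW.ae_unbounded (hS : IsBERW d d₁ d₂ P S)
    (h1 : 1 ≤ d₁) (h1' : d₁ ≤ d) (h2 : 1 ≤ d₂) (h2' : d₂ ≤ d) (c : Fin d)
    (hc1 : c.1 < d₁) (hc2 : d - d₂ ≤ c.1) :
    ∀ᵐ ω ∂P, ∀ M : ℕ, ∃ n, (M : ℤ) < |S n ω c| := by
  classical
  refine ae_all_iff.2 fun M => ?_
  have hd : (1 : ℝ) ≤ d := by exact_mod_cast h1.trans h1'
  have hsq : ∀ x : Fin d → ℤ, sqSum {c} x = (x c : ℝ) ^ 2 := fun x => by simp [sqSum]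
  have hb : ∀ (x : Fin d → ℤ) (K : ℕ), |x c| ≤ K → sqSum {c} x ≤ (K : ℝ) ^ 2 := by
    intro x K hx
    rw [hsq, ← sq_abs]
    have : |(x c : ℝ)| ≤ K := by exact_mod_cast hx
    gcongr
  let alive : List (Fin d → ℤ) → Prop := fun l => ∀ y ∈ l, |y c| ≤ M
  have hfin := hS.ae_finite h1 h1' h2 h2' (Q := alive)
    (ψ := fun l => if alive l then 1 / (d : ℝ) else 0) (a := 1 / d)
    (by positivity) (fun l => by split_ifs <;> positivity) (fun l hl => by rw [if_pos hl])
    (fun N => sum_berwExp_le (φ := fun l => if alive l then ((M + 1 : ℕ) : ℝ) ^ 2 -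
        sqSum {c} (l.headD 0) else 0) (fun l => by
      split_ifs with hl
      · cases l with
        | nil => simp [sqSum]; positivity
        | cons x t =>
          have := hb x (M + 1) ((hl x (by simp)).trans (by push_cast; linarith))
          simp only [List.headD_cons]
          linarith
      · exact le_rfl) (fun x t => by
      have hI := berwDirs_nonempty h1 h1' h2 h2' x t
      rw [berwOp_cons]
      by_cases hl : alive (x :: t)
      · have hx : |x c| ≤ M := hl x (by simp)
        have hy : ∀ y : Fin d → ℤ, |y c| ≤ |x c| + 1 →
            (if alive (y :: x :: t) then ((M + 1 : ℕ) : ℝ) ^ 2 -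
              sqSum {c} ((y :: x :: t).headD 0) else 0) ≤
            ((M + 1 : ℕ) : ℝ) ^ 2 + (-1) * sqSum {c} y := by
          intro y hy
          have := hb y (M + 1) (hy.trans (by push_cast; linarith))
          split_ifs
          · simp only [List.headD_cons]; linarith
          · linarith
        have h3 := nbrAvg_mono (I := berwDirs d d₁ d₂ x t) (x := x)
          (g := fun y => if alive (y :: x :: t) then ((M + 1 : ℕ) : ℝ) ^ 2 -
              sqSum {c} ((y :: x :: t).headD 0) else 0)
          (g' := fun y => ((M + 1 : ℕ) : ℝ) ^ 2 + (-1) * sqSum {c} y) fun i _ =>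
          add_le_add (hy _ (abs_add_unitVec_le x i c).1) (hy _ (abs_add_unitVec_le x i c).2)
        rw [nbrAvg_add, nbrAvg_const hI, nbrAvg_const_mul, nbrAvg_sqSum hI] at h3
        have hcard : berwDirs d d₁ d₂ x t ∩ {c} = {c} := by
          have : c ∈ berwDirs d d₁ d₂ x t := by unfold berwDirs; split_ifs <;> simp <;> omega
          simpa using this
        rw [hcard, Finset.card_singleton] at h3
        have hle : ((berwDirs d d₁ d₂ x t).card : ℝ) ≤ d := by
          have := Finset.card_le_univ (berwDirs d d₁ d₂ x t)
          rw [Fintype.card_fin] at this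
          exact_mod_cast this
        have hpos : (0 : ℝ) < (berwDirs d d₁ d₂ x t).card := by exact_mod_cast hI.card_pos
        have := one_div_le_one_div_of_le hpos hle
        simp only [if_pos hl, List.headD_cons] at h3 ⊢
        push_cast at h3 ⊢
        linarith
      · have hy : ∀ y : Fin d → ℤ, ¬ alive (y :: x :: t) := fun y h =>
          hl fun z hz => h z (List.mem_cons_of_mem _ hz)
        simp only [hy, hl, if_false, nbrAvg_const hI, add_zero, le_refl]) N)
  filter_upwards [hfin] with ω hω
  by_contra! hcon
  refine Set.infinite_univ (hω.subset fun n _ => ?_)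
  intro y hy
  obtain ⟨k, _, rfl⟩ := mem_walkHist.1 hy
  exact hcon k

/-- Transience when the walk moves in at least three directions at new sites that are frozen
at old sites. -/
theorem IsBERW.transient_of_new (hS : IsBERW d d₁ d₂ P S)
    (h1 : 1 ≤ d₁) (h1' : d₁ ≤ d) (h2 : 1 ≤ d₂) (h2' : d₂ ≤ d) (hover : d < d₁ + d₂)
    (hdd : 3 ≤ d - d₂) : IsTransientWalk d P S := by
  classical
  have hd : (1 : ℝ) ≤ d := by exact_mod_cast h1.trans h1'
  set J : Finset (Fin d) := Finset.univ.filter fun i => i.1 < d - d₂ with hJ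
  have hJn : Finset.univ.filter (fun i : Fin d => i.1 < d₁) ∩ J = J := by
    refine Finset.inter_eq_right.2 fun i hi => ?_
    simp only [hJ, Finset.mem_filter, Finset.mem_univ, true_and] at hi ⊢
    omega
  have hJo : Disjoint (Finset.univ.filter fun i : Fin d => d - d₂ ≤ i.1) J := by
    refine Finset.disjoint_left.2 fun i hi hi' => ?_
    simp only [hJ, Finset.mem_filter, Finset.mem_univ, true_and] at hi hi'
    omega
  have hJc : (3 : ℝ) ≤ J.card := by
    rw [hJ, card_newDirs (Nat.sub_le _ _)]
    exact_mod_cast hdd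
  obtain ⟨η, hη, hη96⟩ : ∃ η : ℝ, 0 < η ∧ η = 1 / 48 := ⟨_, by norm_num, rfl⟩
  have hη' : η ≤ 1 / 4 := by rw [hη96]; norm_num
  have hdrift : ∀ (x : Fin d → ℤ) (t : List (Fin d → ℤ)),
      berwOp d d₁ d₂ (fun l => lyapFun J η (l.headD 0)) (x :: t)
      + ((η / (2 * d)) • newPart (lyapDrift J η)) (x :: t) ≤ lyapFun J η ((x :: t).headD 0) := by
    intro x t
    have hwx := (lyapDrift_pos (J := J) (x := x) hη).le
    have hI := berwDirs_nonempty h1 h1' h2 h2' x t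
    simp only [Pi.smul_apply, smul_eq_mul, newPart, berwOp_cons, List.headD_cons]
    split_ifs with hx
    · have hI2 : berwDirs d d₁ d₂ x t = Finset.univ.filter (fun i => d - d₂ ≤ i.1) := by
        simp [berwDirs, hx]
      rw [hI2, nbrAvg_lyapFun_of_disjoint (hI2 ▸ hI) hJo]
      simp
    · have hI2 : berwDirs d d₁ d₂ x t = Finset.univ.filter (fun i => i.1 < d₁) := by
        simp [berwDirs, hx]
      have havg := nbrAvg_lyapFun_le (J := J) (x := x) hη hη' hI
      rw [hI2] at havg ⊢
      rw [hJn, card_newDirs h1'] at havg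
      have hd1 : (1 : ℝ) ≤ d₁ := by exact_mod_cast h1
      have hd1' : (d₁ : ℝ) ≤ d := by exact_mod_cast h1'
      have : η / (2 * d) ≤ η * ((J.card : ℝ) - 2 - 24 * η) / d₁ := by
        rw [div_le_div_iff₀ (by positivity) (by positivity)]
        have e : η * (1 / 2) ≤ η * ((J.card : ℝ) - 2 - 24 * η) :=
          mul_le_mul_of_nonneg_left (by rw [hη96]; linarith) hη.le
        nlinarith
      have := mul_le_mul_of_nonneg_right this hwx
      linarith
  have hnewfin : ∀ᵐ ω ∂P, ∀ x : Fin d → ℤ,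
      {n | S n ω ∉ (walkHist S ω n).tail ∧ sqSum J (S n ω) = sqSum J x}.Finite := by
    refine ae_all_iff.2 fun x => ?_
    have := hS.ae_finite h1 h1' h2 h2'
      (Q := fun l => ∃ y t, l = y :: t ∧ y ∉ t ∧ sqSum J y = sqSum J x)
      (ψ := (η / (2 * d)) • newPart (lyapDrift J η)) (a := η / (2 * d) * lyapDrift J η x)
      (mul_pos (by positivity) (lyapDrift_pos hη))
      (fun l => mul_nonneg (by positivity) (newPart_nonneg (fun y => (lyapDrift_pos hη).le) l))
      (by
        rintro l ⟨y, t, rfl, hy, hyx⟩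
        simp only [Pi.smul_apply, smul_eq_mul, newPart, if_neg hy]
        simp only [lyapDrift, lyapFun, lyapBase, hyx, le_refl])
      (fun N => sum_berwExp_le (fun l => (lyapFun_pos hη).le) hdrift N)
    filter_upwards [this] with ω hω
    refine hω.subset fun n hn => ?_
    exact ⟨S n ω, _, walkHist_eq_cons ω n, hn.1, hn.2⟩
  filter_upwards [hnewfin, hS.ae_step h1 h1' h2 h2',
    hS.ae_unbounded h1 h1' h2 h2' ⟨d₁ - 1, by omega⟩ (by simp; omega) (by simp; omega)]
    with ω hfin hstep hunb x
  by_contra hinf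
  obtain ⟨N, hN⟩ := (hfin x).bddAbove
  obtain ⟨n₀, hn₀, hNn₀⟩ := Set.Infinite.exists_gt hinf N
  have hold : ∀ n, N < n → sqSum J (S n ω) = sqSum J x → S n ω ∈ (walkHist S ω n).tail := by
    intro n hn hsq
    by_contra hcon
    exact absurd (hN ⟨hcon, hsq⟩) (by omega)
  have hproj : ∀ k, sqSum J (S (n₀ + k) ω) = sqSum J x := by
    intro k
    induction k with
    | zero => rw [add_zero, show S n₀ ω = x from hn₀]
    | succ k ih =>
      obtain ⟨i, hi, h⟩ := hstep (n₀ + k)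
      have hiJ : i ∉ J := by
        simp only [berwDirs, if_pos (hold _ (by omega) ih)] at hi
        exact Finset.disjoint_left.1 hJo hi
      rw [← ih, ← add_assoc]
      rcases h with h | h
      · rw [h, sqSum_add, if_neg hiJ, add_zero]
      · rw [h, sqSum_sub, if_neg hiJ, add_zero]
  have hrange : ∀ n, ∃ k ∈ Finset.range (n₀ + 1), S n ω = S k ω := by
    intro n
    induction n using Nat.strong_induction_on with
    | _ n ih =>
      by_cases hn : n < n₀ + 1
      · exact ⟨n, Finset.mem_range.2 hn, rfl⟩
      · obtain ⟨j, rfl⟩ := Nat.exists_eq_add_of_le (show n₀ ≤ n by omega)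
        obtain ⟨k, hk, h⟩ := mem_tail_walkHist.1 (hold _ (by omega) (hproj j))
        rw [← h]
        exact ih k hk
  set c : Fin d := ⟨d₁ - 1, by omega⟩ with hc
  obtain ⟨n, hn⟩ := hunb (∑ k ∈ Finset.range (n₀ + 1), (S k ω c).natAbs)
  obtain ⟨k, hk, h⟩ := hrange n
  have := Finset.single_le_sum (f := fun k => (S k ω c).natAbs) (fun _ _ => Nat.zero_le _) hk
  rw [h, Int.abs_eq_natAbs] at hn
  exact absurd this (not_le.2 (by exact_mod_cast hn))

end Unbounded

section Maximal

variable {d d₁ d₂ : ℕ}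

/-- Some nonempty final segment of the list, i.e. some earlier trajectory, satisfies `Q`. -/
def hitBy (Q : List (Fin d → ℤ) → Prop) : List (Fin d → ℤ) → Prop
  | [] => False
  | x :: t => Q (x :: t) ∨ hitBy Q t

theorem hitBy_walkHist {Ω : Type*} {S : ℕ → Ω → Fin d → ℤ} {Q : List (Fin d → ℤ) → Prop} {ω : Ω}
    {n : ℕ} : hitBy Q (walkHist S ω n) ↔ ∃ k ≤ n, Q (walkHist S ω k) := by
  induction n with
  | zero => simp [walkHist, hitBy]
  | succ n ih =>
    simp only [walkHist, hitBy, ih]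
    constructor
    · rintro (h | ⟨k, hk, h⟩)
      · exact ⟨n + 1, le_rfl, h⟩
      · exact ⟨k, by omega, h⟩
    · rintro ⟨k, hk, h⟩
      rcases Nat.lt_or_eq_of_le hk with h1 | rfl
      · exact Or.inr ⟨k, by omega, h⟩
      · exact Or.inl h

variable {Ω : Type*} [MeasurableSpace Ω] {P : Measure Ω} [IsProbabilityMeasure P]
  {S : ℕ → Ω → Fin d → ℤ}

/-- The maximal inequality for nonnegative supermartingales of the trajectory. -/
theorem IsBERW.measure_exists_le_of_supermartingale (hS : IsBERW d d₁ d₂ P S)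
    (h1 : 1 ≤ d₁) (h1' : d₁ ≤ d) (h2 : 1 ≤ d₂) (h2' : d₂ ≤ d)
    {φ : List (Fin d → ℤ) → ℝ} {Q : List (Fin d → ℤ) → Prop} {a : ℝ} (ha : 0 < a)
    (hφ : ∀ l, 0 ≤ φ l) (hop : ∀ x t, berwOp d d₁ d₂ φ (x :: t) ≤ φ (x :: t))
    (hQ : ∀ x t, Q (x :: t) → a ≤ φ (x :: t)) :
    P {ω | ∃ n, Q (walkHist S ω n)} ≤ ENNReal.ofReal (φ [0] / a) := by
  classical
  have hsum : ∑' n, P {ω | Q (walkHist S ω n) ∧ ¬ hitBy Q (walkHist S ω n).tail} ≤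
      ENNReal.ofReal (φ [0] / a) := by
    refine hS.tsum_measure_le h1 h1' h2 h2' (Q := fun l => Q l ∧ ¬ hitBy Q l.tail) fun N => ?_
    rw [le_div_iff₀ ha, mul_comm, Finset.mul_sum]
    simp only [← berwExp_smul]
    have h0 : (if hitBy Q ([0] : List (Fin d → ℤ)).tail then 0 else φ [0]) = φ [0] := by
      simp [hitBy]
    rw [← h0]
    refine sum_berwExp_le (φ := fun l => if hitBy Q l.tail then 0 else φ l)
      (fun l => by split_ifs <;> simp [hφ]) (fun x t => ?_) N
    have hI := berwDirs_nonempty h1 h1' h2 h2' x t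
    rw [berwOp_cons]
    simp only [List.tail_cons, Pi.smul_apply, smul_eq_mul, hitBy]
    by_cases ht : hitBy Q t
    · simp [ht, nbrAvg_const hI]
    · by_cases hx : Q (x :: t)
      · simpa [ht, hx, nbrAvg_const hI] using hQ x t hx
      · simpa [ht, hx, berwOp_cons] using hop x t
  refine le_trans (measure_mono fun ω hω => ?_) ((measure_iUnion_le _).trans hsum)
  obtain ⟨n, hn⟩ : ∃ n, Q (walkHist S ω n) := hω
  have hex : ∃ n, Q (walkHist S ω n) := ⟨n, hn⟩
  refine Set.mem_iUnion.2 ⟨Nat.find hex, Nat.find_spec hex, ?_⟩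
  intro hcon
  cases hk : Nat.find hex with
  | zero => rw [hk] at hcon; simp [walkHist, hitBy] at hcon
  | succ m =>
    rw [hk] at hcon
    obtain ⟨k, hkm, h⟩ := hitBy_walkHist.1 (show hitBy Q (walkHist S ω m) from hcon)
    exact Nat.find_min hex (by omega : k < Nat.find hex) h

/-- The maximal inequality for a function of the trajectory which is a nonnegative supermartingale
until the walk leaves a domain. -/
theorem IsBERW.measure_exists_le_of_domain (hS : IsBERW d d₁ d₂ P S)
    (h1 : 1 ≤ d₁) (h1' : d₁ ≤ d) (h2 : 1 ≤ d₂) (h2' : d₂ ≤ d)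
    {φ : List (Fin d → ℤ) → ℝ} {Q : List (Fin d → ℤ) → Prop} {D : (Fin d → ℤ) → Prop} {a : ℝ}
    (ha : 0 < a) (h0 : 0 ≤ φ [0]) (hQ0 : ¬ Q [0])
    (hop : ∀ x t, (∀ y ∈ x :: t, D y) → berwOp d d₁ d₂ φ (x :: t) ≤ φ (x :: t))
    (hQ : ∀ x t, (∀ y ∈ x :: t, D y) → ∀ i y, (y = x + unitVec d i ∨ y = x - unitVec d i) →
      0 ≤ φ (y :: x :: t) ∧ (Q (y :: x :: t) → a ≤ φ (y :: x :: t))) :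
    P {ω | ∃ n, (∀ k < n, D (S k ω)) ∧ Q (walkHist S ω n)} ≤ ENNReal.ofReal (φ [0] / a) := by
  classical
  obtain ⟨A, hA⟩ : ∃ A : List (Fin d → ℤ) → Prop, ∀ l, A l ↔ ∀ y ∈ l.tail, D y :=
    ⟨_, fun _ => Iff.rfl⟩
  have hmain := hS.measure_exists_le_of_supermartingale h1 h1' h2 h2'
    (φ := fun l => if A l then max (φ l) 0 else 0) (Q := fun l => A l ∧ a ≤ φ l) ha
    (fun l => by split_ifs <;> simp) (fun x t => by
      have hI := berwDirs_nonempty h1 h1' h2 h2' x t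
      rw [berwOp_cons]
      by_cases hx : ∀ y ∈ x :: t, D y
      · have hA1 : ∀ y, A (y :: x :: t) := fun y => (hA _).2 hx
        have hA2 : A (x :: t) := (hA _).2 fun y hy => hx y (List.mem_cons_of_mem _ hy)
        rw [if_pos hA2]
        refine le_trans ?_ ((hop x t hx).trans (le_max_left _ _))
        rw [berwOp_cons]
        refine nbrAvg_mono fun i _ => ?_
        rw [if_pos (hA1 _), if_pos (hA1 _), max_eq_left (hQ x t hx i _ (Or.inl rfl)).1,
          max_eq_left (hQ x t hx i _ (Or.inr rfl)).1]
      · have hA1 : ∀ y, ¬ A (y :: x :: t) := fun y h => hx ((hA _).1 h)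
        simp only [hA1, if_false, nbrAvg_const hI]
        split_ifs <;> simp)
    (fun x t h => by rw [if_pos h.1]; exact h.2.trans (le_max_left _ _))
  have hz : (if A [0] then max (φ [0]) 0 else 0) = φ [0] := by
    rw [if_pos ((hA _).2 (by simp)), max_eq_left h0]
  rw [hz] at hmain
  refine le_trans (measure_mono_ae ?_) hmain
  filter_upwards [hS.ae_step h1 h1' h2 h2', hS.2.1] with ω hstep h0ω
  rintro ⟨n, hD, hQn⟩
  refine ⟨n, (hA _).2 fun y hy => ?_, ?_⟩
  · obtain ⟨k, hk, rfl⟩ := mem_tail_walkHist.1 hy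
    exact hD k hk
  · cases n with
    | zero =>
      rw [walkHist, h0ω] at hQn
      exact absurd hQn hQ0
    | succ n =>
      obtain ⟨i, _, hi⟩ := hstep n
      rw [show walkHist S ω (n + 1) = S (n + 1) ω :: walkHist S ω n from rfl,
        walkHist_eq_cons ω n] at hQn ⊢
      refine (hQ _ _ (fun y hy => ?_) i _ hi).2 hQn
      rw [← walkHist_eq_cons] at hy
      obtain ⟨k, hk, rfl⟩ := mem_walkHist.1 hy
      exact hD k (by omega)

end Maximal

section Planes

/-- The two coordinates of `ℤ⁴` that are frozen at old sites for `M_4(4,2)`. -/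
abbrev frozenDirs : Finset (Fin 4) := {0, 1}

/-- The two coordinates of `ℤ⁴` that move at old sites for `M_4(4,2)`. -/
abbrev mobileDirs : Finset (Fin 4) := {2, 3}

theorem berwOp_four_four_two (φ : List (Fin 4 → ℤ) → ℝ) (x : Fin 4 → ℤ) (t : List (Fin 4 → ℤ)) :
    berwOp 4 4 2 φ (x :: t) = if x ∈ t then nbrAvg mobileDirs (fun y => φ (y :: x :: t)) x
      else (nbrAvg frozenDirs (fun y => φ (y :: x :: t)) x +
        nbrAvg mobileDirs (fun y => φ (y :: x :: t)) x) / 2 := by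
  rw [berwOp_cons]
  unfold berwDirs
  have e1 : Finset.univ.filter (fun i : Fin 4 => 4 - 2 ≤ i.1) = mobileDirs := by decide
  have e2 : Finset.univ.filter (fun i : Fin 4 => i.1 < 4) = Finset.univ := by decide
  split_ifs with h
  · rw [e1]
  · rw [e2]
    simp only [nbrAvg, Fin.sum_univ_four, frozenDirs, mobileDirs]
    rw [Finset.sum_pair (by decide), Finset.sum_pair (by decide), Finset.card_pair (by decide),
      Finset.card_pair (by decide), Finset.card_univ, Fintype.card_fin]
    push_cast
    ring

variable {d : ℕ}

/-- A subharmonic function of the coordinates in `J`, when `J` has two elements. -/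
noncomputable def logSum (J : Finset (Fin d)) (x : Fin d → ℤ) : ℝ := Real.log (sqSum J x + 1)

variable {J : Finset (Fin d)} {x y : Fin d → ℤ}

theorem logSum_le_of_sqSum_le {r : ℝ} (h : sqSum J x ≤ r) : logSum J x ≤ Real.log (r + 1) :=
  Real.log_le_log (by linarith [sqSum_nonneg (J := J) (x := x)]) (by linarith)

theorem le_logSum_of_le_sqSum {r : ℝ} (hr : 0 ≤ r) (h : r ≤ sqSum J x) :
    Real.log (r + 1) ≤ logSum J x :=
  Real.log_le_log (by linarith) (by linarith)

theorem sqSum_neighbor_of_notMem {i : Fin d} (hi : i ∉ J)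
    (h : y = x + unitVec d i ∨ y = x - unitVec d i) : sqSum J y = sqSum J x := by
  rcases h with rfl | rfl
  · rw [sqSum_add, if_neg hi, add_zero]
  · rw [sqSum_sub, if_neg hi, add_zero]

theorem sqSum_neighbor_le {r : ℝ} (hr : 0 ≤ r) (hx : sqSum J x ≤ r ^ 2) {i : Fin d}
    (h : y = x + unitVec d i ∨ y = x - unitVec d i) : sqSum J y ≤ (r + 1) ^ 2 := by
  by_cases hi : i ∈ J
  · have h1 : (x i : ℝ) ^ 2 ≤ sqSum J x :=
      Finset.single_le_sum (f := fun i => (x i : ℝ) ^ 2) (fun _ _ => sq_nonneg _) hi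
    have h2 := abs_le_of_sq_le_sq' (h1.trans hx) hr
    rcases h with rfl | rfl
    · rw [sqSum_add, if_pos hi]; nlinarith
    · rw [sqSum_sub, if_pos hi]; nlinarith
  · rw [sqSum_neighbor_of_notMem hi h]; nlinarith

theorem sqSum_sub_le {r : ℝ} (hx : sqSum J x ≤ r) (hy : sqSum J y ≤ r) :
    sqSum J (x - y) ≤ 4 * r := by
  have : sqSum J (x - y) ≤ 2 * sqSum J x + 2 * sqSum J y := by
    unfold sqSum
    rw [Finset.mul_sum, Finset.mul_sum, ← Finset.sum_add_distrib]
    refine Finset.sum_le_sum fun i _ => ?_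
    simp only [Pi.sub_apply, Int.cast_sub]
    nlinarith [sq_nonneg ((x i : ℝ) + y i)]
  linarith

theorem nbrAvg_congr {I : Finset (Fin d)} {g g' : (Fin d → ℤ) → ℝ}
    (h : ∀ i ∈ I, ∀ y, (y = x + unitVec d i ∨ y = x - unitVec d i) → g y = g' y) :
    nbrAvg I g x = nbrAvg I g' x := by
  unfold nbrAvg
  congr 1
  exact Finset.sum_congr rfl fun i hi => by rw [h i hi _ (Or.inl rfl), h i hi _ (Or.inr rfl)]

theorem nbrAvg_le_nbrAvg {I : Finset (Fin d)} {g g' : (Fin d → ℤ) → ℝ}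
    (h : ∀ i ∈ I, ∀ y, (y = x + unitVec d i ∨ y = x - unitVec d i) → g y ≤ g' y) :
    nbrAvg I g x ≤ nbrAvg I g' x :=
  nbrAvg_mono fun i hi => add_le_add (h i hi _ (Or.inl rfl)) (h i hi _ (Or.inr rfl))

theorem nbrAvg_sum {ι : Type*} {I : Finset (Fin d)} (s : Finset ι) (g : ι → (Fin d → ℤ) → ℝ) :
    nbrAvg I (fun y => ∑ k ∈ s, g k y) x = ∑ k ∈ s, nbrAvg I (g k) x := by
  unfold nbrAvg
  simp_rw [← Finset.sum_add_distrib]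
  rw [Finset.sum_comm, Finset.sum_div]

theorem log_add_log_add_log_add_log_ge {a b : ℝ} {s : ℝ} (hs : s = a ^ 2 + b ^ 2) :
    4 * Real.log (s + 1) ≤ Real.log (s + (1 + 2 * a) + 1) + Real.log (s + (1 - 2 * a) + 1) +
      (Real.log (s + (1 + 2 * b) + 1) + Real.log (s + (1 - 2 * b) + 1)) := by
  have h1 : 0 < s + (1 + 2 * a) + 1 := by nlinarith [sq_nonneg (a + 1), sq_nonneg b]
  have h2 : 0 < s + (1 - 2 * a) + 1 := by nlinarith [sq_nonneg (a - 1), sq_nonneg b]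
  have h3 : 0 < s + (1 + 2 * b) + 1 := by nlinarith [sq_nonneg (b + 1), sq_nonneg a]
  have h4 : 0 < s + (1 - 2 * b) + 1 := by nlinarith [sq_nonneg (b - 1), sq_nonneg a]
  have hs0 : 0 ≤ s := by rw [hs]; positivity
  rw [← Real.log_mul h1.ne' h2.ne', ← Real.log_mul h3.ne' h4.ne',
    ← Real.log_mul (mul_pos h1 h2).ne' (mul_pos h3 h4).ne']
  rw [show (4 : ℝ) * Real.log (s + 1) = Real.log ((s + 1) ^ 4) by rw [Real.log_pow]; norm_num]
  refine Real.log_le_log (by positivity) ?_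
  have e : (s + (1 + 2 * a) + 1) * (s + (1 - 2 * a) + 1) *
      ((s + (1 + 2 * b) + 1) * (s + (1 - 2 * b) + 1)) =
      (s + 2) ^ 4 - 4 * (s + 2) ^ 2 * (a ^ 2 + b ^ 2) + 16 * a ^ 2 * b ^ 2 := by ring
  rw [e, ← hs]
  have : 0 ≤ 16 * a ^ 2 * b ^ 2 := by positivity
  nlinarith [sq_nonneg s]

theorem logSum_le_nbrAvg {i j : Fin d} (hij : i ≠ j) :
    logSum {i, j} x ≤ nbrAvg {i, j} (logSum {i, j}) x := by
  unfold nbrAvg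
  rw [Finset.sum_pair hij, Finset.card_pair hij, le_div_iff₀ (by norm_num)]
  simp only [logSum, sqSum_add, sqSum_sub, Finset.mem_insert, Finset.mem_singleton, true_or,
    or_true, if_true]
  have := log_add_log_add_log_add_log_ge (a := x i) (b := x j) (s := sqSum {i, j} x)
    (by rw [sqSum, Finset.sum_pair hij])
  push_cast
  linarith

theorem nbrAvg_logSum_of_eq_zero (hJ : J.Nonempty) (h : ∀ i ∈ J, x i = 0) :
    nbrAvg J (logSum J) x = Real.log 2 := by
  have h0 : sqSum J x = 0 := Finset.sum_eq_zero fun i hi => by simp [h i hi]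
  rw [← nbrAvg_const (x := x) hJ (Real.log 2)]
  refine nbrAvg_congr fun i hi y hy => ?_
  unfold logSum
  congr 1
  rcases hy with rfl | rfl
  · rw [sqSum_add, if_pos hi, h0, h i hi]; norm_num
  · rw [sqSum_sub, if_pos hi, h0, h i hi]; norm_num

theorem nbrAvg_translate {I : Finset (Fin d)} (g : (Fin d → ℤ) → ℝ) (z : Fin d → ℤ) :
    nbrAvg I (fun y => g (y - z)) x = nbrAvg I g (x - z) := by
  unfold nbrAvg
  congr 1
  refine Finset.sum_congr rfl fun i _ => ?_
  show g (x + unitVec d i - z) + g (x - unitVec d i - z) = _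
  rw [show x + unitVec d i - z = x - z + unitVec d i by abel,
    show x - unitVec d i - z = x - z - unitVec d i by abel]

theorem nbrAvg_const_sub {I : Finset (Fin d)} (hI : I.Nonempty) (b : ℝ) (g : (Fin d → ℤ) → ℝ) :
    nbrAvg I (fun y => b - g y) x = b - nbrAvg I g x := by
  have := nbrAvg_add (I := I) (x := x) (g := fun _ => b) (g' := fun y => (-1) * g y)
  rw [nbrAvg_const hI, nbrAvg_const_mul] at this
  simp only [neg_one_mul, ← sub_eq_add_neg] at this
  exact this

end Planes

section Escape

variable {d : ℕ} {J : Finset (Fin d)}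

/-- The projection on the coordinates in `J`. -/
def maskTo (J : Finset (Fin d)) (x : Fin d → ℤ) : Fin d → ℤ := fun i => if i ∈ J then x i else 0

theorem sqSum_maskTo (x : Fin d → ℤ) : sqSum J (maskTo J x) = sqSum J x :=
  Finset.sum_congr rfl fun i hi => by simp [maskTo, hi]

theorem sqSum_zero : sqSum J 0 = 0 := by simp [sqSum]

/-- A function of the trajectory comparing the number of sites visited by the projection on
`mobileDirs` with the displacements of the two projections. -/
noncomputable def escapeFun (c L a : ℝ) : List (Fin 4 → ℤ) → ℝ
  | [] => 0
  | x :: t => sqSum mobileDirs x +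
      2 / Real.log 2 * ∑ z ∈ (t.map (maskTo mobileDirs)).toFinset, (L - logSum mobileDirs (x - z)) +
      c * (a - sqSum frozenDirs x)

theorem nbrAvg_frozen_sqSum_mobile (x : Fin 4 → ℤ) :
    nbrAvg frozenDirs (sqSum mobileDirs) x = sqSum mobileDirs x := by
  rw [nbrAvg_sqSum (by simp), show frozenDirs ∩ mobileDirs = ∅ by decide]; simp

theorem nbrAvg_mobile_sqSum_frozen (x : Fin 4 → ℤ) :
    nbrAvg mobileDirs (sqSum frozenDirs) x = sqSum frozenDirs x := by
  rw [nbrAvg_sqSum (by simp), show mobileDirs ∩ frozenDirs = ∅ by decide]; simp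

theorem nbrAvg_sqSum_self (hJ : J.Nonempty) (x : Fin d → ℤ) :
    nbrAvg J (sqSum J) x = sqSum J x + 1 := by
  have : (J.card : ℝ) ≠ 0 := by exact_mod_cast hJ.card_pos.ne'
  rw [nbrAvg_sqSum hJ, Finset.inter_self, div_self this]

theorem nbrAvg_frozen_logSum_mobile (x : Fin 4 → ℤ) :
    nbrAvg frozenDirs (logSum mobileDirs) x = logSum mobileDirs x := by
  rw [← nbrAvg_const (x := x) (I := frozenDirs) (by simp) (logSum mobileDirs x)]
  refine nbrAvg_congr fun i hi y hy => ?_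
  unfold logSum
  rw [sqSum_neighbor_of_notMem (J := mobileDirs) (Finset.disjoint_left.1 (by decide) hi) hy]

theorem nbrAvg_escapeFun {I : Finset (Fin 4)} (hI : I.Nonempty) (c L a : ℝ) (x : Fin 4 → ℤ)
    (t : List (Fin 4 → ℤ)) :
    nbrAvg I (fun y => escapeFun c L a (y :: x :: t)) x = nbrAvg I (sqSum mobileDirs) x +
      2 / Real.log 2 * ∑ z ∈ ((x :: t).map (maskTo mobileDirs)).toFinset,
        (L - nbrAvg I (logSum mobileDirs) (x - z)) + c * (a - nbrAvg I (sqSum frozenDirs) x) := by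
  simp only [escapeFun]
  rw [nbrAvg_add, nbrAvg_add, nbrAvg_const_mul, nbrAvg_const_mul, nbrAvg_const_sub hI, nbrAvg_sum]
  simp only [nbrAvg_const_sub hI]
  simp only [nbrAvg_translate (logSum mobileDirs)]

theorem berwOp_escapeFun_le {c L a : ℝ} (hL : 0 ≤ L) (hc : c = 1 + 2 * (2 / Real.log 2 * L))
    (x : Fin 4 → ℤ) (t : List (Fin 4 → ℤ)) :
    berwOp 4 4 2 (escapeFun c L a) (x :: t) ≤ escapeFun c L a (x :: t) := by
  have hlog : 0 < Real.log 2 := Real.log_pos (by norm_num)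
  have hk : 0 < 2 / Real.log 2 := by positivity
  have hk2 : 2 / Real.log 2 * Real.log 2 = 2 := by field_simp
  have hc0 : 0 < c := by rw [hc]; positivity
  have hV := nbrAvg_escapeFun (I := mobileDirs) (by simp) c L a x t
  have hU := nbrAvg_escapeFun (I := frozenDirs) (by simp) c L a x t
  rw [nbrAvg_sqSum_self (by simp), nbrAvg_mobile_sqSum_frozen] at hV
  rw [nbrAvg_sqSum_self (by simp), nbrAvg_frozen_sqSum_mobile] at hU
  simp only [nbrAvg_frozen_logSum_mobile] at hU
  have hsub : ∀ z, L - nbrAvg mobileDirs (logSum mobileDirs) (x - z) ≤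
      L - logSum mobileDirs (x - z) := fun z => sub_le_sub_left (logSum_le_nbrAvg (by decide)) _
  have hself : ∀ i ∈ mobileDirs, (x - maskTo mobileDirs x) i = 0 := fun i hi => by
    simp only [Pi.sub_apply, maskTo, if_pos hi, sub_self]
  have hselfV := nbrAvg_logSum_of_eq_zero (by simp) hself
  have hself0 : logSum mobileDirs (x - maskTo mobileDirs x) = 0 := by
    have : sqSum mobileDirs (x - maskTo mobileDirs x) = 0 :=
      Finset.sum_eq_zero fun i hi => by simp [hself i hi]
    simp [logSum, this]
  rw [berwOp_four_four_two, hV, hU]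
  simp only [escapeFun, List.map_cons, List.toFinset_cons]
  set A := (t.map (maskTo mobileDirs)).toFinset with hA
  by_cases hx : maskTo mobileDirs x ∈ A
  · rw [Finset.insert_eq_of_mem hx]
    have h1 : ∑ z ∈ A, (L - nbrAvg mobileDirs (logSum mobileDirs) (x - z)) ≤
        ∑ z ∈ A, (L - logSum mobileDirs (x - z)) - Real.log 2 := by
      rw [← Finset.add_sum_erase A _ hx, ← Finset.add_sum_erase A _ hx, hselfV, hself0]
      have := Finset.sum_le_sum fun z (_ : z ∈ A.erase (maskTo mobileDirs x)) => hsub z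
      linarith
    have h2 := mul_le_mul_of_nonneg_left h1 hk.le
    rw [mul_sub, hk2] at h2
    split_ifs <;> linarith
  · have hxt : x ∉ t := fun h => hx (by
      rw [hA, List.mem_toFinset]
      exact List.mem_map_of_mem h)
    rw [if_neg hxt, Finset.sum_insert hx, Finset.sum_insert hx, hselfV, hself0]
    have h1 := mul_le_mul_of_nonneg_left (Finset.sum_le_sum fun z (_ : z ∈ A) => hsub z) hk.le
    have h2 : 2 / Real.log 2 * (L - Real.log 2) ≤ 2 / Real.log 2 * L :=
      mul_le_mul_of_nonneg_left (by linarith) hk.le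
    rw [mul_add, mul_add, sub_zero]
    linarith

variable {Ω : Type*} [MeasurableSpace Ω] {P : Measure Ω} [IsProbabilityMeasure P]
  {S : ℕ → Ω → Fin 4 → ℤ}

/-- The mobile projection is unlikely to travel far before the frozen one does. -/
theorem IsBERW.measure_mobile_first_le (hS : IsBERW 4 4 2 P S) {ρ r : ℝ} (hρ : 0 ≤ ρ) (hr : 0 < r) :
    P {ω | ∃ n, (∀ k < n, sqSum frozenDirs (S k ω) < ρ ^ 2 ∧ sqSum mobileDirs (S k ω) < r ^ 2) ∧
        r ^ 2 ≤ sqSum mobileDirs (S n ω)} ≤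
      ENNReal.ofReal ((1 + 2 * (2 / Real.log 2 * Real.log (4 * (r + 1) ^ 2 + 1))) *
        (ρ + 1) ^ 2 / r ^ 2) := by
  obtain ⟨L, hL⟩ : ∃ L, L = Real.log (4 * (r + 1) ^ 2 + 1) := ⟨_, rfl⟩
  obtain ⟨c, hc⟩ : ∃ c, c = 1 + 2 * (2 / Real.log 2 * L) := ⟨_, rfl⟩
  have hL0 : 0 ≤ L := by rw [hL]; exact Real.log_nonneg (by nlinarith [sq_nonneg (r + 1)])
  have hlog : 0 < Real.log 2 := Real.log_pos (by norm_num)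
  have hc0 : 0 < c := by rw [hc]; positivity
  have hφ0 : escapeFun c L ((ρ + 1) ^ 2) [0] = c * (ρ + 1) ^ 2 := by
    simp [escapeFun, sqSum_zero]
  have hmain := hS.measure_exists_le_of_domain (by norm_num) (by norm_num) (by norm_num)
    (by norm_num) (φ := escapeFun c L ((ρ + 1) ^ 2))
    (Q := fun l => r ^ 2 ≤ sqSum mobileDirs (l.headD 0))
    (D := fun y => sqSum frozenDirs y < ρ ^ 2 ∧ sqSum mobileDirs y < r ^ 2)
    (a := r ^ 2) (by positivity) (by rw [hφ0]; positivity)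
    (by simp only [List.headD_cons, sqSum_zero, not_le]; positivity)
    (fun x t _ => berwOp_escapeFun_le hL0 hc x t) (fun x t hD i y hy => by
      have hx := hD x (by simp)
      have hyU := sqSum_neighbor_le hρ hx.1.le hy
      have hyV := sqSum_neighbor_le hr.le hx.2.le hy
      have hsum : 0 ≤ ∑ z ∈ ((x :: t).map (maskTo mobileDirs)).toFinset,
          (L - logSum mobileDirs (y - z)) := by
        refine Finset.sum_nonneg fun z hz => sub_nonneg.2 ?_
        rw [List.mem_toFinset, List.mem_map] at hz
        obtain ⟨z', hz', rfl⟩ := hz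
        have hz'V := (hD z' hz').2
        rw [hL]
        refine logSum_le_of_sqSum_le (sqSum_sub_le hyV ?_)
        rw [sqSum_maskTo]
        nlinarith
      have h1 : 0 ≤ 2 / Real.log 2 * ∑ z ∈ ((x :: t).map (maskTo mobileDirs)).toFinset,
          (L - logSum mobileDirs (y - z)) := mul_nonneg (by positivity) hsum
      have h2 : 0 ≤ c * ((ρ + 1) ^ 2 - sqSum frozenDirs y) :=
        mul_nonneg hc0.le (sub_nonneg.2 hyU)
      have h3 := sqSum_nonneg (J := mobileDirs) (x := y)
      simp only [escapeFun, List.headD_cons]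
      constructor
      · linarith
      · intro h; linarith)
  rw [hφ0, hc, hL] at hmain
  refine le_trans (measure_mono fun ω hω => ?_) hmain
  obtain ⟨n, hn, hQ⟩ := hω
  refine ⟨n, hn, ?_⟩
  rw [walkHist_eq_cons]
  exact hQ

/-- The frozen projection is unlikely to travel much further than the mobile one. -/
theorem IsBERW.measure_frozen_far_le (hS : IsBERW 4 4 2 P S) {r R : ℝ} (hr : 0 ≤ r) (hR : 0 < R) :
    P {ω | ∃ n, (∀ k < n, sqSum frozenDirs (S k ω) < R ^ 2 ∧ sqSum mobileDirs (S k ω) < r ^ 2) ∧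
        R ^ 2 ≤ sqSum frozenDirs (S n ω)} ≤ ENNReal.ofReal ((r + 1) ^ 2 / R ^ 2) := by
  have hmain := hS.measure_exists_le_of_domain (by norm_num) (by norm_num) (by norm_num)
    (by norm_num)
    (φ := fun l => sqSum frozenDirs (l.headD 0) + ((r + 1) ^ 2 - sqSum mobileDirs (l.headD 0)))
    (Q := fun l => R ^ 2 ≤ sqSum frozenDirs (l.headD 0))
    (D := fun y => sqSum frozenDirs y < R ^ 2 ∧ sqSum mobileDirs y < r ^ 2)
    (a := R ^ 2) (by positivity)
    (by simp only [List.headD_cons, sqSum_zero, sub_zero, zero_add]; positivity)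
    (by simp only [List.headD_cons, sqSum_zero, not_le]; positivity)
    (fun x t _ => by
      rw [berwOp_four_four_two]
      simp only [List.headD_cons]
      rw [nbrAvg_add, nbrAvg_add, nbrAvg_const_sub (by simp), nbrAvg_const_sub (by simp),
        nbrAvg_sqSum_self (by simp), nbrAvg_sqSum_self (by simp), nbrAvg_frozen_sqSum_mobile,
        nbrAvg_mobile_sqSum_frozen]
      split_ifs <;> linarith)
    (fun x t hD i y hy => by
      have hyV := sqSum_neighbor_le hr (hD x (by simp)).2.le hy
      have h3 := sqSum_nonneg (J := frozenDirs) (x := y)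
      simp only [List.headD_cons]
      constructor
      · linarith
      · intro h; linarith)
  simp only [List.headD_cons, sqSum_zero, zero_add, sub_zero] at hmain
  refine le_trans (measure_mono fun ω hω => ?_) hmain
  obtain ⟨n, hn, hQ⟩ := hω
  refine ⟨n, hn, ?_⟩
  rw [walkHist_eq_cons]
  exact hQ

end Escape

section Hitting

open Classical in
/-- A supermartingale which is constant until the projection on `J` travels a distance `ρ`, and
logarithmic in the norm of that projection afterwards. -/
noncomputable def stageFun {d : ℕ} (J : Finset (Fin d)) (ρ L : ℝ) (l : List (Fin d → ℤ)) : ℝ :=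
  if ∃ y ∈ l, ρ ^ 2 ≤ sqSum J y then L - logSum J (l.headD 0) else L - Real.log (ρ ^ 2 + 1)

variable {d : ℕ} {J : Finset (Fin d)} {ρ L : ℝ} {x : Fin d → ℤ} {t : List (Fin d → ℤ)}

theorem stageFun_nonneg {r : ℝ} (hx : sqSum J x ≤ r) (hρ : ρ ^ 2 ≤ r) :
    0 ≤ stageFun J ρ (Real.log (r + 1)) (x :: t) := by
  unfold stageFun
  split_ifs
  · exact sub_nonneg.2 (logSum_le_of_sqSum_le hx)
  · exact sub_nonneg.2 (Real.log_le_log (by positivity) (by linarith))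

theorem stageFun_neighbor_of_notMem {i : Fin d} (hi : i ∉ J) {y : Fin d → ℤ}
    (h : y = x + unitVec d i ∨ y = x - unitVec d i) :
    stageFun J ρ L (y :: x :: t) = stageFun J ρ L (x :: t) := by
  have hs := sqSum_neighbor_of_notMem hi h
  have : (∃ z ∈ y :: x :: t, ρ ^ 2 ≤ sqSum J z) ↔ ∃ z ∈ x :: t, ρ ^ 2 ≤ sqSum J z := by
    simp [hs]
  simp only [stageFun, this, List.headD_cons, logSum, hs]

theorem nbrAvg_stageFun_le {i j : Fin d} (hij : i ≠ j) :
    nbrAvg {i, j} (fun y => stageFun {i, j} ρ L (y :: x :: t)) x ≤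
      stageFun {i, j} ρ L (x :: t) := by
  by_cases h : ∃ z ∈ x :: t, ρ ^ 2 ≤ sqSum {i, j} z
  · have h' : ∀ y, ∃ z ∈ y :: x :: t, ρ ^ 2 ≤ sqSum {i, j} z := fun y => by
      obtain ⟨z, hz, h⟩ := h
      exact ⟨z, List.mem_cons_of_mem _ hz, h⟩
    simp only [stageFun, if_pos h, if_pos (h' _), List.headD_cons]
    rw [nbrAvg_const_sub (by simp)]
    exact sub_le_sub_left (logSum_le_nbrAvg hij) _
  · have hle : ∀ y, stageFun {i, j} ρ L (y :: x :: t) ≤ L - Real.log (ρ ^ 2 + 1) := by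
      intro y
      unfold stageFun
      split_ifs with hy
      · obtain ⟨z, hz, hzρ⟩ := hy
        rcases List.mem_cons.1 hz with rfl | hz
        · exact sub_le_sub_left (le_logSum_of_le_sqSum (sq_nonneg _) hzρ) _
        · exact absurd ⟨z, hz, hzρ⟩ h
      · exact le_rfl
    refine (nbrAvg_le_nbrAvg (g' := fun _ => L - Real.log (ρ ^ 2 + 1)) fun _ _ y _ => hle y).trans ?_
    rw [nbrAvg_const (by simp), stageFun, if_neg h]

variable {Ω : Type*} [MeasurableSpace Ω] {P : Measure Ω} [IsProbabilityMeasure P]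
  {S : ℕ → Ω → Fin 4 → ℤ}

/-- A fixed site is unlikely to be hit after both projections have travelled far. -/
theorem IsBERW.measure_hit_le (hS : IsBERW 4 4 2 P S) {ρ R r r' : ℝ} (hρ : 0 < ρ) (hρR : ρ ≤ R)
    (hr : 0 < r) (hrr' : r ≤ r') (p : Fin 4 → ℤ)
    (hp : sqSum frozenDirs p < (R + 1) ^ 2) (hp' : sqSum mobileDirs p < (r' + 1) ^ 2) :
    P {ω | ∃ n, (∀ k < n, sqSum frozenDirs (S k ω) < R ^ 2 ∧ sqSum mobileDirs (S k ω) < r' ^ 2) ∧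
        S n ω = p ∧ (∃ k ≤ n, ρ ^ 2 ≤ sqSum frozenDirs (S k ω)) ∧
        ∃ k ≤ n, r ^ 2 ≤ sqSum mobileDirs (S k ω)} ≤
      ENNReal.ofReal ((Real.log ((R + 1) ^ 2 + 1) - Real.log (ρ ^ 2 + 1)) *
        (Real.log ((r' + 1) ^ 2 + 1) - Real.log (r ^ 2 + 1)) /
        ((Real.log ((R + 1) ^ 2 + 1) - logSum frozenDirs p) *
          (Real.log ((r' + 1) ^ 2 + 1) - logSum mobileDirs p))) := by
  set L := Real.log ((R + 1) ^ 2 + 1) with hL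
  set L' := Real.log ((r' + 1) ^ 2 + 1) with hL'
  have hρR' : ρ ^ 2 ≤ (R + 1) ^ 2 := by nlinarith
  have hrr'' : r ^ 2 ≤ (r' + 1) ^ 2 := by nlinarith
  have hpos : 0 < L - logSum frozenDirs p := sub_pos.2
    (Real.log_lt_log (by linarith [sqSum_nonneg (J := frozenDirs) (x := p)]) (by linarith))
  have hpos' : 0 < L' - logSum mobileDirs p := sub_pos.2
    (Real.log_lt_log (by linarith [sqSum_nonneg (J := mobileDirs) (x := p)]) (by linarith))
  have hnn : ∀ y t, sqSum frozenDirs y ≤ (R + 1) ^ 2 → sqSum mobileDirs y ≤ (r' + 1) ^ 2 →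
      0 ≤ stageFun frozenDirs ρ L (y :: t) ∧ 0 ≤ stageFun mobileDirs r L' (y :: t) :=
    fun y t h h' => ⟨stageFun_nonneg h hρR', stageFun_nonneg h' hrr''⟩
  have h0 : stageFun frozenDirs ρ L [0] = L - Real.log (ρ ^ 2 + 1) := by
    have : ¬ ∃ y ∈ ([0] : List (Fin 4 → ℤ)), ρ ^ 2 ≤ sqSum frozenDirs y := by
      simp only [List.mem_singleton, exists_eq_left, sqSum_zero, not_le]; positivity
    rw [stageFun, if_neg this]
  have h0' : stageFun mobileDirs r L' [0] = L' - Real.log (r ^ 2 + 1) := by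
    have : ¬ ∃ y ∈ ([0] : List (Fin 4 → ℤ)), r ^ 2 ≤ sqSum mobileDirs y := by
      simp only [List.mem_singleton, exists_eq_left, sqSum_zero, not_le]; positivity
    rw [stageFun, if_neg this]
  have hmain := hS.measure_exists_le_of_domain (by norm_num) (by norm_num) (by norm_num)
    (by norm_num) (φ := fun l => stageFun frozenDirs ρ L l * stageFun mobileDirs r L' l)
    (Q := fun l => l.headD 0 = p ∧ (∃ y ∈ l, ρ ^ 2 ≤ sqSum frozenDirs y) ∧
      ∃ y ∈ l, r ^ 2 ≤ sqSum mobileDirs y)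
    (D := fun y => sqSum frozenDirs y < R ^ 2 ∧ sqSum mobileDirs y < r' ^ 2)
    (mul_pos hpos hpos')
    (mul_nonneg (hnn 0 [] (by rw [sqSum_zero]; positivity) (by rw [sqSum_zero]; positivity)).1
      (hnn 0 [] (by rw [sqSum_zero]; positivity) (by rw [sqSum_zero]; positivity)).2)
    (by
      rintro ⟨_, ⟨y, hy, h⟩, _⟩
      rw [List.mem_singleton.1 hy, sqSum_zero] at h
      exact absurd h (not_le.2 (by positivity)))
    (fun x t hD => by
      have hx := hD x (by simp)
      obtain ⟨h1, h2⟩ := hnn x t (by nlinarith) (by nlinarith)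
      have hV : nbrAvg mobileDirs (fun y => stageFun frozenDirs ρ L (y :: x :: t) *
          stageFun mobileDirs r L' (y :: x :: t)) x ≤
          stageFun frozenDirs ρ L (x :: t) * stageFun mobileDirs r L' (x :: t) := by
        rw [nbrAvg_congr (g' := fun y => stageFun frozenDirs ρ L (x :: t) *
          stageFun mobileDirs r L' (y :: x :: t)) fun i hi y hy => by
            rw [stageFun_neighbor_of_notMem (Finset.disjoint_left.1 (by decide) hi) hy],
          nbrAvg_const_mul]
        exact mul_le_mul_of_nonneg_left (nbrAvg_stageFun_le (by decide)) h1
      have hU : nbrAvg frozenDirs (fun y => stageFun frozenDirs ρ L (y :: x :: t) *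
          stageFun mobileDirs r L' (y :: x :: t)) x ≤
          stageFun frozenDirs ρ L (x :: t) * stageFun mobileDirs r L' (x :: t) := by
        rw [nbrAvg_congr (g' := fun y => stageFun mobileDirs r L' (x :: t) *
          stageFun frozenDirs ρ L (y :: x :: t)) fun i hi y hy => by
            rw [stageFun_neighbor_of_notMem (J := mobileDirs)
              (Finset.disjoint_left.1 (by decide) hi) hy, mul_comm],
          nbrAvg_const_mul, mul_comm]
        exact mul_le_mul_of_nonneg_right (nbrAvg_stageFun_le (by decide)) h2
      rw [berwOp_four_four_two]
      split_ifs <;> linarith)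
    (fun x t hD i y hy => by
      have hx := hD x (by simp)
      have hyU := sqSum_neighbor_le (by linarith) hx.1.le hy
      have hyV := sqSum_neighbor_le (by linarith) hx.2.le hy
      obtain ⟨h1, h2⟩ := hnn y (x :: t) hyU hyV
      refine ⟨mul_nonneg h1 h2, ?_⟩
      rintro ⟨rfl, h3, h4⟩
      rw [stageFun, if_pos h3, stageFun, if_pos h4])
  rw [h0, h0'] at hmain
  refine le_trans (measure_mono fun ω hω => ?_) hmain
  obtain ⟨n, hn, hnp, ⟨k, hk, hkρ⟩, ⟨m, hm, hmr⟩⟩ := hω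
  refine ⟨n, hn, ?_, ⟨_, mem_walkHist.2 ⟨k, hk, rfl⟩, hkρ⟩, ⟨_, mem_walkHist.2 ⟨m, hm, rfl⟩, hmr⟩⟩
  rw [walkHist_eq_cons]
  exact hnp

end Hitting

section Scales

/-- If every scale `j ≥ j₀` avoids the three exceptional events, then a path that has reached mobile
scale `j₀` before time `n` is not at `p` at time `n`. -/
theorem not_hit_of_scales {f g : ℕ → ℝ} {n j₀ : ℕ} {ρ R r : ℕ → ℝ} {hit : Prop}
    (hr : Tendsto r atTop atTop)
    (hmob : ∀ j ≥ j₀, ¬ ∃ n, (∀ k < n, f k < ρ j ∧ g k < r j) ∧ r j ≤ g n)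
    (hfro : ∀ j ≥ j₀, ¬ ∃ n, (∀ k < n, f k < R j ∧ g k < r (j + 1)) ∧ R j ≤ f n)
    (hhit : ∀ j ≥ j₀, ¬ ((∀ k < n, f k < R j ∧ g k < r (j + 1)) ∧ hit ∧
      (∃ k ≤ n, ρ j ≤ f k) ∧ ∃ k ≤ n, r j ≤ g k))
    (hg0 : ∀ k, 0 ≤ g k) (hstart : ∃ k ≤ n, r j₀ ≤ g k) : ¬ hit := by
  intro hp
  have hstep : ∀ j ≥ j₀, ∃ k ≤ n, r j ≤ g k := by
    intro j hj
    induction j, hj using Nat.le_induction with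
    | base => exact hstart
    | succ j hj ih =>
      by_contra! hlt
      have hR : ∀ k ≤ n, f k < R j := by
        intro k
        induction k using Nat.strong_induction_on with
        | _ k ihk =>
          intro hk
          by_contra! hkR
          exact hfro j hj ⟨k, fun i hi => ⟨ihk i hi (by omega), hlt i (by omega)⟩, hkR⟩
      refine hhit j hj ⟨fun k hk => ⟨hR k hk.le, hlt k hk.le⟩, hp, ?_, ih⟩
      by_contra! hρ
      classical
      obtain ⟨hle, hge⟩ := Nat.find_spec ih
      exact hmob j hj ⟨Nat.find ih, fun k hk => ⟨hρ k (by omega), by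
        have := Nat.find_min ih hk
        push Not at this
        exact this (by omega)⟩, hge⟩
  obtain ⟨j, hj, hj'⟩ := ((hr.eventually_gt_atTop (∑ k ∈ Finset.range (n + 1), g k)).and
    (eventually_ge_atTop j₀)).exists
  obtain ⟨k, hk, hkj⟩ := hstep j hj'
  have := Finset.single_le_sum (f := g) (fun i _ => hg0 i)
    (Finset.mem_range.2 (Nat.lt_succ_of_le hk))
  linarith

theorem escape_bound {x r : ℝ} {j : ℕ} (hx : x = j) (hr : r = 2 ^ j) (hx1 : 1 ≤ x)
    (hxr : x ^ 2 ≤ r) :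
    (1 + 2 * (2 / Real.log 2 * Real.log (4 * (r + 1) ^ 2 + 1))) * (r / x ^ 2 + 1) ^ 2 / r ^ 2 ≤
      116 * (Real.sqrt x / x ^ 2) := by
  have hr1 : 1 ≤ r := by nlinarith
  have hlog : 0 < Real.log 2 := Real.log_pos (by norm_num)
  have hL : Real.log (4 * (r + 1) ^ 2 + 1) ≤ (2 * x + 5) * Real.log 2 := by
    have h : 4 * (r + 1) ^ 2 + 1 ≤ 2 ^ (2 * j + 5) := by
      have : (2 : ℝ) ^ (2 * j + 5) = 32 * r ^ 2 := by rw [hr]; ring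
      nlinarith
    refine (Real.log_le_log (by positivity) h).trans_eq ?_
    rw [Real.log_pow, hx]
    push_cast
    ring
  have hK : 1 + 2 * (2 / Real.log 2 * Real.log (4 * (r + 1) ^ 2 + 1)) ≤ 29 * x := by
    have : 2 / Real.log 2 * Real.log (4 * (r + 1) ^ 2 + 1) ≤ 2 * (2 * x + 5) := by
      rw [div_mul_eq_mul_div, div_le_iff₀ hlog]
      nlinarith
    linarith
  have hρ : (r / x ^ 2 + 1) ^ 2 ≤ 4 * (r / x ^ 2) ^ 2 := by
    have : 1 ≤ r / x ^ 2 := (one_le_div (by positivity)).2 hxr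
    nlinarith
  have hs : 1 ≤ Real.sqrt x := Real.one_le_sqrt.2 hx1
  calc _ ≤ 29 * x * (4 * (r / x ^ 2) ^ 2) / r ^ 2 := by
        gcongr
    _ = 116 * (1 / x ^ 3) := by field_simp; norm_num
    _ ≤ 116 * (Real.sqrt x / x ^ 2) := by
        have : 1 / x ^ 3 ≤ Real.sqrt x / x ^ 2 :=
          div_le_div₀ (by positivity) hs (by positivity) (pow_le_pow_right₀ hx1 (by norm_num))
        linarith

theorem far_bound {x r : ℝ} (hx1 : 1 ≤ x) (hr1 : 1 ≤ r) :
    (2 * r + 1) ^ 2 / (r * x) ^ 2 ≤ 9 * (Real.sqrt x / x ^ 2) := by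
  have hs : 1 ≤ Real.sqrt x := Real.one_le_sqrt.2 hx1
  calc (2 * r + 1) ^ 2 / (r * x) ^ 2 ≤ (3 * r) ^ 2 / (r * x) ^ 2 := by gcongr; linarith
    _ = 9 * (1 / x ^ 2) := by field_simp; norm_num
    _ ≤ 9 * (Real.sqrt x / x ^ 2) := by gcongr

theorem hit_bound {x r A A' : ℝ} {j : ℕ} (hx : x = j) (hr : r = 2 ^ j) (hx1 : 1 ≤ x)
    (hxr : x ^ 2 ≤ r) (hA : 3 * A ≤ x) (hA' : 3 * A' ≤ x) :
    (Real.log ((r * x + 1) ^ 2 + 1) - Real.log ((r / x ^ 2) ^ 2 + 1)) *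
        (Real.log ((2 * r + 1) ^ 2 + 1) - Real.log (r ^ 2 + 1)) /
        ((Real.log ((r * x + 1) ^ 2 + 1) - A) * (Real.log ((2 * r + 1) ^ 2 + 1) - A')) ≤
      153 * (Real.sqrt x / x ^ 2) := by
  have hr1 : 1 ≤ r := by nlinarith
  have hrx : 1 ≤ r * x := by nlinarith
  have hs : 1 ≤ Real.sqrt x := Real.one_le_sqrt.2 hx1
  have hlogx : Real.log x ≤ 2 * Real.sqrt x := by
    have h := Real.log_sqrt (by linarith : 0 ≤ x)
    have h' := Real.log_le_sub_one_of_pos (by positivity : 0 < Real.sqrt x)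
    linarith
  have h1 : Real.log ((r * x + 1) ^ 2 + 1) - Real.log ((r / x ^ 2) ^ 2 + 1) ≤
      17 * Real.sqrt x := by
    have ha : Real.log ((r * x + 1) ^ 2 + 1) ≤ Real.log (5 * x ^ 6 * (r / x ^ 2) ^ 2) := by
      apply Real.log_le_log (by positivity)
      have : 5 * x ^ 6 * (r / x ^ 2) ^ 2 = 5 * (r * x) ^ 2 := by field_simp
      nlinarith
    have hb : Real.log ((r / x ^ 2) ^ 2) ≤ Real.log ((r / x ^ 2) ^ 2 + 1) :=
      Real.log_le_log (by positivity) (by linarith)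
    rw [Real.log_mul (by positivity) (by positivity), Real.log_mul (by norm_num) (by positivity),
      Real.log_pow] at ha
    have h5 := Real.log_le_sub_one_of_pos (by norm_num : (0 : ℝ) < 5)
    push_cast at ha
    linarith
  have h2 : Real.log ((2 * r + 1) ^ 2 + 1) - Real.log (r ^ 2 + 1) ≤ 9 := by
    have ha : Real.log ((2 * r + 1) ^ 2 + 1) ≤ Real.log (10 * r ^ 2) :=
      Real.log_le_log (by positivity) (by nlinarith)
    have hb : Real.log (r ^ 2) ≤ Real.log (r ^ 2 + 1) :=
      Real.log_le_log (by positivity) (by linarith)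
    rw [Real.log_mul (by norm_num) (by positivity)] at ha
    have h10 := Real.log_le_sub_one_of_pos (by norm_num : (0 : ℝ) < 10)
    linarith
  have h2' : 0 ≤ Real.log ((2 * r + 1) ^ 2 + 1) - Real.log (r ^ 2 + 1) :=
    sub_nonneg.2 (Real.log_le_log (by positivity) (by nlinarith))
  have hlogr : (4 / 3) * x ≤ Real.log (r ^ 2) := by
    rw [Real.log_pow, hr, Real.log_pow, ← hx]
    have := Real.log_two_gt_d9
    push_cast
    nlinarith
  have h3 : x ≤ Real.log ((r * x + 1) ^ 2 + 1) - A := by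
    have : Real.log (r ^ 2) ≤ Real.log ((r * x + 1) ^ 2 + 1) := by
      refine Real.log_le_log (by positivity) ?_
      have : r ≤ r * x := le_mul_of_one_le_right (by linarith) hx1
      nlinarith
    linarith
  have h4 : x ≤ Real.log ((2 * r + 1) ^ 2 + 1) - A' := by
    have : Real.log (r ^ 2) ≤ Real.log ((2 * r + 1) ^ 2 + 1) :=
      Real.log_le_log (by positivity) (by nlinarith)
    linarith
  calc _ ≤ 17 * Real.sqrt x * 9 / (x * x) := by
        apply div_le_div₀ (by positivity) _ (by positivity)
        · exact mul_le_mul h3 h4 (by linarith) (by linarith)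
        · exact mul_le_mul h1 h2 h2' (by positivity)
    _ = 153 * (Real.sqrt x / x ^ 2) := by ring

theorem summable_sqrt_div_sq : Summable fun j : ℕ => Real.sqrt j / (j : ℝ) ^ 2 := by
  refine (Real.summable_nat_rpow.2 (by norm_num : (-3 / 2 : ℝ) < -1)).congr fun j => ?_
  rcases Nat.eq_zero_or_pos j with rfl | hj
  · simp [Real.zero_rpow]
  · have : (0 : ℝ) < j := by exact_mod_cast hj
    rw [Real.sqrt_eq_rpow, ← Real.rpow_natCast, ← Real.rpow_sub this]
    norm_num

variable {Ω : Type*} [MeasurableSpace Ω] {P : Measure Ω} [IsProbabilityMeasure P]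
  {S : ℕ → Ω → Fin 4 → ℤ}

theorem IsBERW.transient_four_four_two (hS : IsBERW 4 4 2 P S) : IsTransientWalk 4 P S := by
  refine ae_all_iff.2 fun p => ?_
  obtain ⟨r, hr⟩ : ∃ r : ℕ → ℝ, r = fun j => 2 ^ j := ⟨_, rfl⟩
  have hrj : ∀ j, r j = 2 ^ j := fun j => by rw [hr]
  have hr1 : ∀ j, r (j + 1) = 2 * r j := fun j => by rw [hrj, hrj, pow_succ]; ring
  have hrpos : ∀ j, 0 < r j := fun j => by rw [hrj]; positivity
  have hrtop : Tendsto r atTop atTop := by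
    rw [hr]; exact tendsto_pow_atTop_atTop_of_one_lt (by norm_num)
  let E₁ : ℕ → Set Ω := fun j => {ω | ∃ n,
    (∀ k < n, sqSum frozenDirs (S k ω) < (r j / j ^ 2) ^ 2 ∧ sqSum mobileDirs (S k ω) < r j ^ 2) ∧
      r j ^ 2 ≤ sqSum mobileDirs (S n ω)}
  let E₂ : ℕ → Set Ω := fun j => {ω | ∃ n,
    (∀ k < n, sqSum frozenDirs (S k ω) < (r j * j) ^ 2 ∧
      sqSum mobileDirs (S k ω) < r (j + 1) ^ 2) ∧ (r j * j) ^ 2 ≤ sqSum frozenDirs (S n ω)}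
  let E₃ : ℕ → Set Ω := fun j => {ω | ∃ n,
    (∀ k < n, sqSum frozenDirs (S k ω) < (r j * j) ^ 2 ∧
      sqSum mobileDirs (S k ω) < r (j + 1) ^ 2) ∧ S n ω = p ∧
      (∃ k ≤ n, (r j / j ^ 2) ^ 2 ≤ sqSum frozenDirs (S k ω)) ∧
      ∃ k ≤ n, r j ^ 2 ≤ sqSum mobileDirs (S k ω)}
  have hbound : ∀ᶠ j : ℕ in atTop, P (E₁ j ∪ E₂ j ∪ E₃ j) ≤
      ENNReal.ofReal (278 * (Real.sqrt j / (j : ℝ) ^ 2)) := by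
    have hcast := tendsto_natCast_atTop_atTop (R := ℝ)
    have hexp : ∀ᶠ j : ℕ in atTop, (j : ℝ) ^ 2 ≤ 2 ^ j := by
      filter_upwards [eventually_ge_atTop 4] with j hj
      have : j ^ 2 ≤ 2 ^ j := by
        induction j, hj using Nat.le_induction with
        | base => norm_num
        | succ j hj ih => rw [pow_succ 2 j]; nlinarith
      exact_mod_cast this
    filter_upwards [hexp, hcast.eventually_ge_atTop 1,
      hcast.eventually_ge_atTop (3 * logSum frozenDirs p),
      hcast.eventually_ge_atTop (3 * logSum mobileDirs p),
      hrtop.eventually_ge_atTop (sqSum frozenDirs p),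
      hrtop.eventually_ge_atTop (sqSum mobileDirs p)] with j hj2 hj1 hA hA' hpf hpm
    rw [← hrj] at hj2
    have hrge : 1 ≤ r j := by nlinarith
    have hrx : r j ≤ r j * j := by nlinarith
    have hρpos : 0 < r j / (j : ℝ) ^ 2 := div_pos (hrpos j) (by positivity)
    have hρr : r j / (j : ℝ) ^ 2 ≤ r j := div_le_self (hrpos j).le (by nlinarith)
    have b₁ := (hS.measure_mobile_first_le hρpos.le (hrpos j)).trans
      (ENNReal.ofReal_le_ofReal (escape_bound rfl (hrj j) hj1 hj2))
    have b₂ := hS.measure_frozen_far_le (hrpos (j + 1)).le ((hrpos j).trans_le hrx)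
    have b₃ := hS.measure_hit_le hρpos (hρr.trans hrx) (hrpos j)
      (by rw [hr1]; linarith [hrpos j] : r j ≤ r (j + 1)) p (by nlinarith)
      (by rw [hr1]; nlinarith)
    rw [hr1] at b₂ b₃
    replace b₂ := b₂.trans (ENNReal.ofReal_le_ofReal (far_bound hj1 hrge))
    replace b₃ := b₃.trans
      (ENNReal.ofReal_le_ofReal (hit_bound rfl (hrj j) hj1 hj2 hA hA'))
    rw [← hr1] at b₂ b₃
    have hq : 0 ≤ Real.sqrt j / (j : ℝ) ^ 2 := by positivity
    refine (measure_union_le _ _).trans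
      ((add_le_add ((measure_union_le _ _).trans (add_le_add b₁ b₂)) b₃).trans ?_)
    rw [← ENNReal.ofReal_add (by positivity) (by positivity),
      ← ENNReal.ofReal_add (by positivity) (by positivity)]
    exact ENNReal.ofReal_le_ofReal (by linarith)
  obtain ⟨J, hJ⟩ := eventually_atTop.1 hbound
  have hfin : ∀ᵐ ω ∂P, {i | ω ∈ E₁ (i + J) ∪ E₂ (i + J) ∪ E₃ (i + J)}.Finite := by
    apply ae_finite_setOfPred_mem
    refine ne_top_of_le_ne_top ?_ (ENNReal.tsum_le_tsum fun i => hJ (i + J) (by omega))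
    exact ((summable_nat_add_iff J).2 (summable_sqrt_div_sq.mul_left 278)).tsum_ofReal_ne_top
  filter_upwards [hfin, hS.ae_unbounded (by norm_num) (by norm_num) (by norm_num) (by norm_num) 3
    (by decide) (by decide)] with ω hω hunb
  obtain ⟨N, hN⟩ := hω.bddAbove
  have hgood : ∀ j ≥ N + 1 + J, ω ∉ E₁ j ∪ E₂ j ∪ E₃ j := by
    intro j hj hmem
    have h : j - J + J = j := by omega
    have := hN (show ω ∈ E₁ (j - J + J) ∪ E₂ (j - J + J) ∪ E₃ (j - J + J) by rwa [h])
    omega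
  obtain ⟨m, hm⟩ := hunb (2 ^ (N + 1 + J))
  have hm' : r (N + 1 + J) ^ 2 ≤ sqSum mobileDirs (S m ω) := by
    have h1 : r (N + 1 + J) ≤ |(S m ω 3 : ℝ)| := by
      rw [hrj]
      exact_mod_cast hm.le
    have h2 : sqSum mobileDirs (S m ω) = (S m ω 2 : ℝ) ^ 2 + (S m ω 3 : ℝ) ^ 2 := by
      simp [sqSum]
    rw [h2, ← sq_abs (S m ω 3 : ℝ)]
    nlinarith [sq_nonneg (S m ω 2 : ℝ), hrpos (N + 1 + J)]
  refine (Set.finite_lt_nat m).subset fun n hn => ?_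
  by_contra hmn
  replace hmn : m ≤ n := not_lt.1 hmn
  have hsq : Tendsto (fun j => r j ^ 2) atTop atTop :=
    (tendsto_pow_atTop two_ne_zero).comp hrtop
  exact not_hit_of_scales (f := fun k => sqSum frozenDirs (S k ω))
    (g := fun k => sqSum mobileDirs (S k ω)) (n := n) (j₀ := N + 1 + J)
    (ρ := fun j => (r j / j ^ 2) ^ 2) (R := fun j => (r j * j) ^ 2) (r := fun j => r j ^ 2)
    (hit := S n ω = p) hsq
    (fun j hj h => hgood j hj (Or.inl (Or.inl h))) (fun j hj h => hgood j hj (Or.inl (Or.inr h)))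
    (fun j hj h => hgood j hj (Or.inr ⟨n, h⟩)) (fun _ => sqSum_nonneg) ⟨m, hmn, hm'⟩ hn

end Scales

/-- For every `(d, d₁, d₂)` with `d ≥ 4`, `1 ≤ d₁, d₂ ≤ d`, `d₁ + d₂ > d` and
`(d, d₁, d₂) ≠ (4, 3, 2)`, the `M_d(d₁,d₂)` balanced excited random walk is transient. -/
theorem berw_transient_overlapping {Ω : Type*} [MeasurableSpace Ω] (P : Measure Ω)
    [IsProbabilityMeasure P] (d d₁ d₂ : ℕ)
    (hd : 4 ≤ d) (hd₁ : 1 ≤ d₁) (hd₁' : d₁ ≤ d) (hd₂ : 1 ≤ d₂) (hd₂' : d₂ ≤ d)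
    (hover : d < d₁ + d₂) (hne : (d, d₁, d₂) ≠ (4, 3, 2))
    (S : ℕ → Ω → Fin d → ℤ) (hS : IsBERW d d₁ d₂ P S) :
    IsTransientWalk d P S := by
  by_cases h3 : 3 ≤ d₂
  · rcases Nat.lt_or_ge d₁ 2 with h | h
    · obtain rfl : d₁ = 1 := by omega
      obtain rfl : d₂ = d := by omega
      refine hS.transient_of_old hd₁ hd₁' hd₂ hd₂' (Finset.univ.erase ⟨0, by omega⟩) (Or.inl ?_) ?_
      · refine Finset.disjoint_left.2 fun i hi hi' => ?_
        simp only [Finset.mem_filter, Finset.mem_univ, true_and] at hi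
        exact Finset.ne_of_mem_erase hi' (Fin.ext (by simpa using hi))
      · rw [Finset.filter_true_of_mem fun i _ => by simp, Finset.univ_inter,
          Finset.card_erase_of_mem (Finset.mem_univ _), Finset.card_univ, Fintype.card_fin]
        omega
    · refine hS.transient_of_old hd₁ hd₁' hd₂ hd₂' Finset.univ (Or.inr ?_) ?_
      · rwa [Finset.inter_univ, card_newDirs hd₁']
      · rwa [Finset.inter_univ, card_oldDirs hd₂']
  · by_cases h : 3 ≤ d - d₂
    · exact hS.transient_of_new hd₁ hd₁' hd₂ hd₂' hover h
    · obtain rfl : d = 4 := by omega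
      obtain rfl : d₂ = 2 := by omega
      obtain rfl : d₁ = 4 := by
        have : d₁ ≠ 3 := by rintro rfl; exact hne rfl
        omega
      exact hS.transient_four_four_two
end

section
/- Let d ≥ 2, 1 ≤ d₁, d₂ ≤ d with d₁ + d₂ > d, and set r := d₁ + d₂ − d. If r ≥ 3, then the M_d(d₁,d₂) balanced excited random walk is transient: the restriction of the walk to the r overlapping coordinates (coordinates d−d₂+1,…,d₁) moves at each step with probability bounded below, and each of its moves is a step of a symmetric random walk in at least 3 dimensions, so almost surely every site of ℤ^d is visited only finitely many times. -/
open MeasureTheory Filter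

/-- A quadratic upper bound for `u ↦ (1 + u) ^ (-1/4)` near `0`. -/
lemma one_add_rpow_neg_quarter_le {u : ℝ} (hu : |u| ≤ 1 / 10) :
    (1 + u) ^ (-(1 / 4) : ℝ) ≤ 1 - u / 4 + 3 / 16 * u ^ 2 := by
  obtain ⟨h₁, h₂⟩ := abs_le.1 hu
  have hpos : 0 < 1 + u := by linarith
  set v := (1 + u) ^ (-(1 / 4) : ℝ) with hv
  have hv4 : v ^ 4 * (1 + u) = 1 := by
    rw [hv, ← Real.rpow_natCast, ← Real.rpow_mul hpos.le]
    norm_num [Real.rpow_neg_one, hpos.ne']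
  have hw : 0 < 1 - u / 4 + 3 / 16 * u ^ 2 := by nlinarith
  by_contra! hlt
  have h4 := pow_lt_pow_left₀ hlt hw.le (n := 4) (by norm_num)
  have hkey : 1 ≤ (1 - u / 4 + 3 / 16 * u ^ 2) ^ 4 * (1 + u) := by
    have hm : 1 - u / 2 + 17 / 40 * u ^ 2 ≤ (1 - u / 4 + 3 / 16 * u ^ 2) ^ 2 := by
      have : (1 - u / 4 + 3 / 16 * u ^ 2) ^ 2 - (1 - u / 2 + 17 / 40 * u ^ 2)
          = u ^ 2 * (1 / 80 - 3 / 32 * u + 9 / 256 * u ^ 2) := by ring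
      have : 0 ≤ u ^ 2 * (1 / 80 - 3 / 32 * u + 9 / 256 * u ^ 2) :=
        mul_nonneg (sq_nonneg u) (by nlinarith [sq_nonneg u])
      linarith
    have hm0 : 0 ≤ 1 - u / 2 + 17 / 40 * u ^ 2 := by nlinarith [sq_nonneg u]
    calc 1 ≤ (1 - u / 2 + 17 / 40 * u ^ 2) ^ 2 * (1 + u) := by
          have hexp : (1 - u / 2 + 17 / 40 * u ^ 2) ^ 2 * (1 + u) - 1
              = u ^ 2 * (1 / 10 + 27 / 40 * u - u ^ 2 * (391 / 1600 - 289 / 1600 * u)) := by ring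
          have hu2 : u ^ 2 ≤ 1 / 100 := by nlinarith
          have : 0 ≤ u ^ 2 * (1 / 10 + 27 / 40 * u - u ^ 2 * (391 / 1600 - 289 / 1600 * u)) :=
            mul_nonneg (sq_nonneg u) (by nlinarith [sq_nonneg u])
          linarith
      _ ≤ ((1 - u / 4 + 3 / 16 * u ^ 2) ^ 2) ^ 2 * (1 + u) := by gcongr
      _ = _ := by ring
  nlinarith [mul_lt_mul_of_pos_right h4 hpos]

/-- A Bernoulli-type lower bound for `s ↦ (1 - s) ^ (-1/4)`. -/
lemma one_add_le_one_sub_rpow_neg_quarter {s : ℝ} (hs : 0 ≤ s) (hs' : s < 1) :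
    1 + s / 4 ≤ (1 - s) ^ (-(1 / 4) : ℝ) := by
  have hpos : 0 < 1 - s := by linarith
  set v := (1 - s) ^ (-(1 / 4) : ℝ) with hv
  have hv0 : 0 < v := Real.rpow_pos_of_pos hpos _
  have hv4 : v ^ 4 * (1 - s) = 1 := by
    rw [hv, ← Real.rpow_natCast, ← Real.rpow_mul hpos.le]
    norm_num [Real.rpow_neg_one, hpos.ne']
  by_contra! hlt
  have h4 := pow_lt_pow_left₀ hlt hv0.le (n := 4) (by norm_num)
  have hkey : (1 + s / 4) ^ 4 * (1 - s) ≤ 1 := by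
    have : (1 + s / 4) ^ 4 * (1 - s)
        = 1 - (5 / 8 * s ^ 2 + 5 / 16 * s ^ 3 + 15 / 256 * s ^ 4 + 1 / 256 * s ^ 5) := by ring
    rw [this]
    have : 0 ≤ 5 / 8 * s ^ 2 + 5 / 16 * s ^ 3 + 15 / 256 * s ^ 4 + 1 / 256 * s ^ 5 := by positivity
    linarith
  nlinarith [mul_lt_mul_of_pos_right h4 hpos]

lemma rpow_neg_quarter_add_le {A t : ℝ} (hA : 101 + t ^ 2 ≤ A) :
    (A + 2 * t) ^ (-(1 / 4) : ℝ) + (A - 2 * t) ^ (-(1 / 4) : ℝ)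
      ≤ A ^ (-(1 / 4) : ℝ) * (2 + 3 / 2 * (t ^ 2 / A ^ 2)) := by
  have hA0 : 0 < A := by nlinarith [sq_nonneg t]
  have hu : |2 * t / A| ≤ 1 / 10 := by
    rw [abs_le]
    constructor
    · rw [le_div_iff₀ hA0]; nlinarith [sq_nonneg (t + 10)]
    · rw [div_le_iff₀ hA0]; nlinarith [sq_nonneg (t - 10)]
  have hu' : |-(2 * t / A)| ≤ 1 / 10 := by rwa [abs_neg]
  obtain ⟨h₁, h₂⟩ := abs_le.1 hu
  have e₁ : A + 2 * t = A * (1 + 2 * t / A) := by field_simp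
  have e₂ : A - 2 * t = A * (1 + -(2 * t / A)) := by field_simp; ring
  rw [e₁, e₂, Real.mul_rpow hA0.le (by linarith), Real.mul_rpow hA0.le (by linarith), ← mul_add]
  refine mul_le_mul_of_nonneg_left ?_ (Real.rpow_nonneg hA0.le _)
  have := one_add_rpow_neg_quarter_le hu
  have := one_add_rpow_neg_quarter_le hu'
  have : (2 * t / A) ^ 2 = 4 * (t ^ 2 / A ^ 2) := by ring
  nlinarith

/-- A bounded function of the coordinates in `T`, strictly superharmonic for the simple random walk
on these coordinates if there are at least three of them. -/
noncomputable def potential {d : ℕ} (T : Finset (Fin d)) (x : Fin d → ℤ) : ℝ :=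
  (100 + ∑ i ∈ T, (x i : ℝ) ^ 2) ^ (-(1 / 4) : ℝ)

lemma potential_nonneg {d : ℕ} (T : Finset (Fin d)) (x : Fin d → ℤ) : 0 ≤ potential T x := by
  unfold potential; positivity

lemma potential_le_one {d : ℕ} (T : Finset (Fin d)) (x : Fin d → ℤ) : potential T x ≤ 1 := by
  refine Real.rpow_le_one_of_one_le_of_nonpos ?_ (by norm_num)
  have : 0 ≤ ∑ i ∈ T, (x i : ℝ) ^ 2 := by positivity
  linarith

lemma sum_sq_add_smul_unitVec {d : ℕ} {T : Finset (Fin d)} {i : Fin d} (hi : i ∈ T)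
    (x : Fin d → ℤ) (ε : ℤ) :
    ∑ j ∈ T, (((x + ε • unitVec d i) j : ℤ) : ℝ) ^ 2
      = ∑ j ∈ T, (x j : ℝ) ^ 2 + 2 * ε * x i + (ε : ℝ) ^ 2 := by
  have : ∀ j ∈ T, (((x + ε • unitVec d i) j : ℤ) : ℝ) ^ 2
      = (x j : ℝ) ^ 2 + if j = i then 2 * ε * x i + (ε : ℝ) ^ 2 else 0 := by
    intro j _
    by_cases h : j = i
    · subst h; simp [unitVec]; ring
    · simp [unitVec, h]
  rw [Finset.sum_congr rfl this, Finset.sum_add_distrib, Finset.sum_ite_eq' T i, if_pos hi, add_assoc]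

lemma potential_add_smul_unitVec_of_notMem {d : ℕ} {T : Finset (Fin d)} {i : Fin d} (hi : i ∉ T)
    (x : Fin d → ℤ) (ε : ℤ) : potential T (x + ε • unitVec d i) = potential T x := by
  unfold potential
  congr 2
  refine Finset.sum_congr rfl fun j hj => ?_
  have : j ≠ i := fun h => hi (h ▸ hj)
  simp [unitVec, this]

/-- Minus the discrete Laplacian of `potential T` in the coordinates of `T`. -/
noncomputable def potentialDrop {d : ℕ} (T : Finset (Fin d)) (x : Fin d → ℤ) : ℝ :=
  ∑ i ∈ T, (2 * potential T x - potential T (x + (1 : ℤ) • unitVec d i)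
    - potential T (x + (-1 : ℤ) • unitVec d i))

lemma potentialDrop_pos {d : ℕ} {T : Finset (Fin d)} (hT : T.card = 3) (x : Fin d → ℤ) :
    0 < potentialDrop T x := by
  set Q := ∑ i ∈ T, (x i : ℝ) ^ 2 with hQ
  have hQ0 : 0 ≤ Q := by positivity
  set A := 101 + Q with hA
  have hA0 : 0 < A := by linarith
  have hterm : ∀ i ∈ T, potential T (x + (1 : ℤ) • unitVec d i)
      + potential T (x + (-1 : ℤ) • unitVec d i)
      ≤ A ^ (-(1 / 4) : ℝ) * (2 + 3 / 2 * ((x i : ℝ) ^ 2 / A ^ 2)) := by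
    intro i hi
    have hle : (x i : ℝ) ^ 2 ≤ Q :=
      Finset.single_le_sum (f := fun i => (x i : ℝ) ^ 2) (fun _ _ => sq_nonneg _) hi
    have := rpow_neg_quarter_add_le (A := A) (t := x i) (by linarith)
    unfold potential
    rw [sum_sq_add_smul_unitVec hi, sum_sq_add_smul_unitVec hi, ← hQ]
    convert this using 3 <;> (push_cast; ring)
  have hsum : ∑ i ∈ T, A ^ (-(1 / 4) : ℝ) * (2 + 3 / 2 * ((x i : ℝ) ^ 2 / A ^ 2))
      = A ^ (-(1 / 4) : ℝ) * (6 + 3 / 2 * (Q / A ^ 2)) := by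
    rw [← Finset.mul_sum, Finset.sum_add_distrib, ← Finset.mul_sum, ← Finset.sum_div, ← hQ]
    simp [hT]; norm_num
  have hB : A ^ (-(1 / 4) : ℝ) * (1 + 1 / A / 4) ≤ potential T x := by
    have h1 : 1 / A < 1 := by rw [div_lt_one hA0]; linarith
    have e : 100 + Q = A * (1 - 1 / A) := by rw [hA]; field_simp; ring
    unfold potential
    rw [← hQ, e, Real.mul_rpow hA0.le (by linarith)]
    exact mul_le_mul_of_nonneg_left
      (one_add_le_one_sub_rpow_neg_quarter (by positivity) h1) (Real.rpow_nonneg hA0.le _)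
  have hlt : Q / A ^ 2 < 1 / A := by
    rw [div_lt_div_iff₀ (by positivity) hA0]; nlinarith
  have hAp : 0 < A ^ (-(1 / 4) : ℝ) := Real.rpow_pos_of_pos hA0 _
  have hle := Finset.sum_le_sum hterm
  rw [hsum] at hle
  have hdrop : potentialDrop T x = 6 * potential T x - ∑ i ∈ T,
      (potential T (x + (1 : ℤ) • unitVec d i) + potential T (x + (-1 : ℤ) • unitVec d i)) := by
    unfold potentialDrop
    simp_rw [sub_sub]
    rw [Finset.sum_sub_distrib]
    simp [hT]; ring
  rw [hdrop]
  nlinarith [mul_lt_mul_of_pos_left hlt hAp]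

lemma sum_one_sub_potential {d : ℕ} {T J : Finset (Fin d)} (hTJ : T ⊆ J) (x : Fin d → ℤ) :
    ∑ i ∈ J, ((1 - potential T (x + (1 : ℤ) • unitVec d i))
      + (1 - potential T (x + (-1 : ℤ) • unitVec d i)))
      = 2 * J.card * (1 - potential T x) + potentialDrop T x := by
  have h : potentialDrop T x = ∑ i ∈ J, (2 * potential T x
      - potential T (x + (1 : ℤ) • unitVec d i) - potential T (x + (-1 : ℤ) • unitVec d i)) := by
    refine Finset.sum_subset hTJ fun i _ hi => ?_
    rw [potential_add_smul_unitVec_of_notMem hi, potential_add_smul_unitVec_of_notMem hi]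
    ring
  rw [h]
  have : 2 * (J.card : ℝ) * (1 - potential T x) = ∑ i ∈ J, 2 * (1 - potential T x) := by
    simp; ring
  rw [this, ← Finset.sum_add_distrib]
  exact Finset.sum_congr rfl fun i _ => by ring

lemma smul_unitVec_injective {d : ℕ} {i j : Fin d} {ε δ : ℤ} (hε : ε ≠ 0)
    (h : ε • unitVec d i = δ • unitVec d j) : i = j ∧ ε = δ := by
  have hi := congrFun h i
  by_cases hij : i = j
  · subst hij; simpa [unitVec] using hi
  · simp [unitVec, hij, hε] at hi

/-- One step of the walk on a fixed history event `H` raises the mean of `1 - potential T`. -/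
lemma setLIntegral_one_sub_potential_step {Ω : Type*} [MeasurableSpace Ω] {P : Measure Ω}
    {d : ℕ} {T J : Finset (Fin d)} (hTJ : T ⊆ J) (hJ : J.Nonempty)
    (hdrop : ∀ x, 0 < potentialDrop T x)
    {X : Ω → Fin d → ℤ} (hX : Measurable X) {H : Set Ω} (x : Fin d → ℤ)
    (hstep : ∀ i ∈ J, ∀ ε : ℤ, ε = 1 ∨ ε = -1 →
      P (H ∩ {ω | X ω = x + ε • unitVec d i}) = P H / (2 * J.card)) :
    (ENNReal.ofReal (1 - potential T x) + ENNReal.ofReal (potentialDrop T x / (2 * d))) * P H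
      ≤ ∫⁻ ω in H, ENNReal.ofReal (1 - potential T (X ω)) ∂P := by
  have hcard : 0 < (J.card : ℝ) := by exact_mod_cast hJ.card_pos
  set E : Finset ℤ := {1, -1} with hE
  have hE' : ∀ ε ∈ E, ε = 1 ∨ ε = -1 := by simp [hE]
  set nb : Fin d × ℤ → Fin d → ℤ := fun p => x + p.2 • unitVec d p.1 with hnb
  set φ : (Fin d → ℤ) → ENNReal := fun y => ENNReal.ofReal (1 - potential T y) with hφ
  have hinj : Set.InjOn nb (J ×ˢ E : Finset (Fin d × ℤ)) := by
    rintro ⟨i, ε⟩ hp ⟨j, δ⟩ _ h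
    have hε : ε ≠ 0 := by
      rcases hE' ε (Finset.mem_product.1 hp).2 with h | h <;> simp [h]
    obtain ⟨h₁, h₂⟩ := smul_unitVec_injective hε (add_left_cancel h)
    exact Prod.ext h₁ h₂
  have hms : ∀ y, MeasurableSet {ω | X ω = y} := fun y => hX (measurableSet_singleton y)
  have hpt : ∀ ω, ∑ p ∈ J ×ˢ E, {ω | X ω = nb p}.indicator (fun _ => φ (nb p)) ω ≤ φ (X ω) := by
    intro ω
    by_cases hex : ∃ p ∈ J ×ˢ E, X ω = nb p
    · obtain ⟨p, hp, hXp⟩ := hex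
      rw [Finset.sum_eq_single_of_mem p hp]
      · simp [hXp]
      · intro q hq hqp
        refine Set.indicator_of_notMem (fun (hXq : X ω = nb q) => hqp ?_) _
        exact hinj hq hp (hXq.symm.trans hXp)
    · push Not at hex
      rw [Finset.sum_eq_zero]
      · exact zero_le
      · exact fun q hq => Set.indicator_of_notMem (hex q hq) _
  have hreal : (1 - potential T x) + potentialDrop T x / (2 * d)
      ≤ (∑ p ∈ J ×ˢ E, (1 - potential T (nb p))) / (2 * J.card) := by
    have hsum : ∑ p ∈ J ×ˢ E, (1 - potential T (nb p))
        = 2 * J.card * (1 - potential T x) + potentialDrop T x := by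
      rw [Finset.sum_product, ← sum_one_sub_potential hTJ]
      refine Finset.sum_congr rfl fun i _ => ?_
      rw [hE, Finset.sum_pair (by norm_num)]
    have hle : (J.card : ℝ) ≤ d := by
      have := J.card_le_univ
      rw [Fintype.card_fin] at this
      exact_mod_cast this
    have : potentialDrop T x / (2 * d) ≤ potentialDrop T x / (2 * J.card) :=
      div_le_div_of_nonneg_left (hdrop x).le (by positivity) (by linarith)
    rw [hsum, add_div, mul_div_cancel_left₀ _ (by positivity)]
    linarith
  have hcardE : (2 * J.card : ENNReal) = ENNReal.ofReal (2 * J.card) := by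
    rw [ENNReal.ofReal_mul (by norm_num)]; simp
  calc _ = ENNReal.ofReal ((1 - potential T x) + potentialDrop T x / (2 * d)) * P H := by
        rw [ENNReal.ofReal_add (by linarith [potential_le_one T x])
          (div_nonneg (hdrop x).le (by positivity))]
    _ ≤ ENNReal.ofReal ((∑ p ∈ J ×ˢ E, (1 - potential T (nb p))) / (2 * J.card)) * P H := by
        gcongr
    _ = ∑ p ∈ J ×ˢ E, φ (nb p) * (P H / (2 * J.card)) := by
        rw [ENNReal.ofReal_div_of_pos (by positivity),
          ENNReal.ofReal_sum_of_nonneg (fun p _ => by linarith [potential_le_one T (nb p)]),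
          ← Finset.sum_mul, hcardE, div_eq_mul_inv, div_eq_mul_inv]
        ring
    _ = ∑ p ∈ J ×ˢ E, ∫⁻ ω in H, {ω | X ω = nb p}.indicator (fun _ => φ (nb p)) ω ∂P := by
        refine Finset.sum_congr rfl fun p hp => ?_
        obtain ⟨h₁, h₂⟩ := Finset.mem_product.1 hp
        rw [lintegral_indicator_const (hms _), Measure.restrict_apply (hms _), Set.inter_comm,
          hstep p.1 h₁ p.2 (hE' _ h₂)]
    _ = ∫⁻ ω in H, ∑ p ∈ J ×ˢ E, {ω | X ω = nb p}.indicator (fun _ => φ (nb p)) ω ∂P :=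
        (lintegral_finsetSum _ fun p _ => measurable_const.indicator (hms _)).symm
    _ ≤ _ := lintegral_mono hpt

lemma lintegral_eq_tsum_fiber {Ω β : Type*} [MeasurableSpace Ω] [MeasurableSpace β] [Countable β]
    [MeasurableSingletonClass β] {P : Measure Ω} {Y : Ω → β} (hY : Measurable Y)
    (F : Ω → ENNReal) : ∫⁻ ω, F ω ∂P = ∑' b, ∫⁻ ω in Y ⁻¹' {b}, F ω ∂P := by
  rw [← lintegral_iUnion (fun b => hY (measurableSet_singleton b)), ← Set.preimage_iUnion,
    Set.iUnion_of_singleton, Set.preimage_univ, Measure.restrict_univ]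
  intro a b hab
  exact Disjoint.preimage _ (by simpa using hab)

lemma IsBERW.lintegral_step {Ω : Type*} [MeasurableSpace Ω] {P : Measure Ω} {d d₁ d₂ : ℕ}
    (hd₁ : d₁ ≤ d) (hd₂ : d₂ ≤ d) {S : ℕ → Ω → Fin d → ℤ} (hS : IsBERW d d₁ d₂ P S)
    {T : Finset (Fin d)} (hT : T.card = 3) (hT₁ : ∀ i ∈ T, i.1 < d₁)
    (hT₂ : ∀ i ∈ T, d - d₂ ≤ i.1) (n : ℕ) :
    ∫⁻ ω, ENNReal.ofReal (1 - potential T (S n ω)) ∂P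
      + ∫⁻ ω, ENNReal.ofReal (potentialDrop T (S n ω) / (2 * d)) ∂P
      ≤ ∫⁻ ω, ENNReal.ofReal (1 - potential T (S (n + 1) ω)) ∂P := by
  obtain ⟨hmeas, -, hnew, hold⟩ := hS
  set Y : Ω → Fin (n + 1) → Fin d → ℤ := fun ω k => S k ω with hYdef
  have hY : Measurable Y := measurable_pi_lambda _ fun k => hmeas k
  have hTne : T.Nonempty := Finset.card_pos.1 (by omega)
  have hm : Measurable fun ω => ENNReal.ofReal (1 - potential T (S n ω)) :=
    (measurable_of_countable fun x : Fin d → ℤ => ENNReal.ofReal (1 - potential T x)).comp (hmeas n)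
  rw [← lintegral_add_left hm, lintegral_eq_tsum_fiber hY, lintegral_eq_tsum_fiber hY]
  refine ENNReal.tsum_le_tsum fun v => ?_
  set h : ℕ → Fin d → ℤ := fun k => if hk : k < n + 1 then v ⟨k, hk⟩ else 0 with hh
  have hH : Y ⁻¹' {v} = {ω | ∀ k ≤ n, S k ω = h k} := by
    ext ω
    simp only [Set.mem_preimage, Set.mem_singleton_iff, Set.mem_ofPred_eq,
      hYdef, hh, funext_iff (f := fun k : Fin (n + 1) => S k ω)]
    constructor
    · intro H k hk
      rw [dif_pos (by omega : k < n + 1)]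
      exact H ⟨k, by omega⟩
    · intro H k
      have := H k.1 (by omega)
      rwa [dif_pos k.2] at this
  have hHm : MeasurableSet {ω | ∀ k ≤ n, S k ω = h k} := hH ▸ hY (measurableSet_singleton v)
  rw [hH]
  have hconst : ∫⁻ ω in {ω | ∀ k ≤ n, S k ω = h k}, (ENNReal.ofReal (1 - potential T (S n ω))
      + ENNReal.ofReal (potentialDrop T (S n ω) / (2 * d))) ∂P
      = (ENNReal.ofReal (1 - potential T (h n)) + ENNReal.ofReal (potentialDrop T (h n) / (2 * d)))
        * P {ω | ∀ k ≤ n, S k ω = h k} := by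
    rw [← setLIntegral_const]
    refine setLIntegral_congr_fun hHm fun ω hω => ?_
    simp only [hω n le_rfl]
  rw [hconst]
  by_cases hex : ∃ k < n, h n = h k
  · have hcard : (Finset.univ.filter fun i : Fin d => d - d₂ ≤ i.1).card = d₂ := by
      have := Fin.card_filter_val_lt (n := d) (m := d - d₂)
      have h2 := Finset.card_filter_add_card_filter_not (s := (Finset.univ : Finset (Fin d)))
        (fun i : Fin d => i.1 < d - d₂)
      simp only [not_lt, Finset.card_univ, Fintype.card_fin] at h2
      omega
    have hTJ : T ⊆ Finset.univ.filter fun i : Fin d => d - d₂ ≤ i.1 :=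
      fun i hi => by simpa using hT₂ i hi
    refine setLIntegral_one_sub_potential_step hTJ (hTne.mono hTJ) (potentialDrop_pos hT)
      (hmeas (n + 1)) (h n) fun i hi ε hε => ?_
    rw [hcard]
    exact hold n h hex i (Finset.mem_filter.1 hi).2 ε hε
  · push Not at hex
    have hcard : (Finset.univ.filter fun i : Fin d => i.1 < d₁).card = d₁ := by
      rw [Fin.card_filter_val_lt]; omega
    have hTJ : T ⊆ Finset.univ.filter fun i : Fin d => i.1 < d₁ :=
      fun i hi => by simpa using hT₁ i hi
    refine setLIntegral_one_sub_potential_step hTJ (hTne.mono hTJ) (potentialDrop_pos hT)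
      (hmeas (n + 1)) (h n) fun i hi ε hε => ?_
    rw [hcard]
    exact hnew n h hex i (Finset.mem_filter.1 hi).2 ε hε

/-- If the number `r := d₁ + d₂ − d` of overlapping coordinates is at least `3`,
then the `M_d(d₁,d₂)` balanced excited random walk is transient. -/
theorem berw_transient_of_three_overlapping_coords {Ω : Type*} [MeasurableSpace Ω]
    (P : Measure Ω) [IsProbabilityMeasure P] (d d₁ d₂ r : ℕ)
    (hd : 2 ≤ d) (hd₁ : 1 ≤ d₁) (hd₁' : d₁ ≤ d) (hd₂ : 1 ≤ d₂) (hd₂' : d₂ ≤ d)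
    (hover : d < d₁ + d₂) (hr : r = d₁ + d₂ - d) (hr3 : 3 ≤ r)
    (S : ℕ → Ω → Fin d → ℤ) (hS : IsBERW d d₁ d₂ P S) :
    IsTransientWalk d P S := by
  obtain ⟨T, hTs, hT⟩ := Finset.exists_subset_card_eq
    (s := Finset.univ.filter fun i : Fin d => d - d₂ ≤ i.1 ∧ i.1 < d₁) (n := 3) (by
      let f : Fin 3 → Fin d := fun k => ⟨d - d₂ + k, by omega⟩
      have hf : Function.Injective f := fun a b hab => by
        have := congrArg Fin.val hab
        simp only [f] at this
        omega
      calc 3 = (Finset.univ.image f).card := by simp [Finset.card_image_of_injective _ hf]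
        _ ≤ _ := Finset.card_le_card fun i hi => by
          obtain ⟨k, -, rfl⟩ := Finset.mem_image.1 hi
          simp only [Finset.mem_filter, Finset.mem_univ, true_and, f]
          omega)
  have hT₁ : ∀ i ∈ T, i.1 < d₁ := fun i hi => (Finset.mem_filter.1 (hTs hi)).2.2
  have hT₂ : ∀ i ∈ T, d - d₂ ≤ i.1 := fun i hi => (Finset.mem_filter.1 (hTs hi)).2.1
  set κ : (Fin d → ℤ) → ENNReal := fun x => ENNReal.ofReal (potentialDrop T x / (2 * d)) with hκ
  have hκm : ∀ n, Measurable fun ω => κ (S n ω) :=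
    fun n => (measurable_of_countable κ).comp (hS.1 n)
  have hpartial : ∀ N, ∑ n ∈ Finset.range N, ∫⁻ ω, κ (S n ω) ∂P
      ≤ ∫⁻ ω, ENNReal.ofReal (1 - potential T (S N ω)) ∂P := by
    intro N
    induction N with
    | zero => simp
    | succ N ih =>
      rw [Finset.sum_range_succ]
      exact (add_le_add_left ih _).trans (hS.lintegral_step hd₁' hd₂' hT hT₁ hT₂ N)
  have hbound : ∫⁻ ω, ∑' n, κ (S n ω) ∂P ≤ 1 := by
    rw [lintegral_tsum fun n => (hκm n).aemeasurable]
    refine ENNReal.tsum_le_of_sum_range_le fun N => (hpartial N).trans ?_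
    calc _ ≤ ∫⁻ _, 1 ∂P := lintegral_mono fun ω => by
          rw [← ENNReal.ofReal_one]
          exact ENNReal.ofReal_le_ofReal (by linarith [potential_nonneg T (S N ω)])
      _ = 1 := by simp
  filter_upwards [ae_lt_top (Measurable.tsum hκm) (hbound.trans_lt ENNReal.one_lt_top).ne]
    with ω hω x
  have hx : κ x ≠ 0 := by
    have : (0 : ℝ) < d := by exact_mod_cast (by omega : 0 < d)
    exact (ENNReal.ofReal_pos.2 (div_pos (potentialDrop_pos hT x) (by positivity))).ne'
  exact (ENNReal.finite_const_le_of_tsum_ne_top hω.ne hx).subset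
    fun n (hn : S n ω = x) => (congrArg κ hn).ge
end
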